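/- arXiv:1005.1140 — 3 statements merged into one kernel-verified Lean document; each statement's English description precedes it below -/
import Mathlib

section
/- Suppose K is a simple polygon in the plane with aco K > −π. Then for any point x ∉ K there exists an angular region A with apex x such that ∠A = π + aco K and A ∩ K = ∅. -/
open Real Set Pointwise

noncomputable section

/-- The signed angle from `v` to `w`, in `(-π, π]`; for nonzero non-opposite
vectors it lies in `(-π, π)` and its sign is the sign of the skew product. -/
def vangle (v w : ℝ × ℝ) : ℝ :=
  Complex.arg ((w.1 + w.2 * Complex.I) / (v.1 + v.2 * Complex.I))

/-- `w` is opposite to `v` : `w = a • v` with `a < 0`. -/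
def Opp (v w : ℝ × ℝ) : Prop := ∃ a : ℝ, a < 0 ∧ w = a • v

/-- A shift sequence is non-reverse if no two consecutive shifts are opposite. -/
def NonReverse (s : List (ℝ × ℝ)) : Prop := List.Chain' (fun v w => ¬ Opp v w) s

/-- The rotation of a polyline with the given shift sequence:
the sum of the signed angles between consecutive shifts. -/
def rotShifts : List (ℝ × ℝ) → ℝ
  | v :: w :: rest => vangle v w + rotShifts (w :: rest)
  | _ => 0

/-- The angular convexity of a polyline with shift sequence `s` :
the minimum of the rotations of its contiguous subpolylines. -/
def acoShifts (s : List (ℝ × ℝ)) : ℝ :=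
  sInf (rotShifts '' { t : List (ℝ × ℝ) | t <:+: s })

/-- The (cyclic) rotation of a closed polyline with shift sequence `s`. -/
def rotClosed (s : List (ℝ × ℝ)) : ℝ := rotShifts (s ++ s.take 1)

/-- The angular convexity of a closed polyline with shift sequence `s` :
the minimum of the rotations over all (possibly wrapping) contiguous
subpolylines traversing the cycle at most once, oriented along it. -/
def acoClosed (s : List (ℝ × ℝ)) : ℝ :=
  sInf (rotShifts '' { t : List (ℝ × ℝ) | t.length ≤ s.length ∧ t <:+: (s ++ s) })

/-- A polyline, given by its first vertex and its shift sequence. -/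
structure Polyline where
  start : ℝ × ℝ
  shifts : List (ℝ × ℝ)

namespace Polyline

/-- A genuine polyline: at least one edge and consecutive vertices distinct. -/
def Proper (P : Polyline) : Prop := P.shifts ≠ [] ∧ ∀ v ∈ P.shifts, v ≠ 0

/-- The `i`-th vertex (`0`-indexed). -/
def vert (P : Polyline) (i : ℕ) : ℝ × ℝ := P.start + (P.shifts.take i).sum

/-- The natural piecewise-linear parameterization of `P` on `[0, number of edges]`. -/
def param (P : Polyline) (t : ℝ) : ℝ × ℝ :=
  P.vert ⌊t⌋.toNat + Int.fract t • P.shifts.getD ⌊t⌋.toNat 0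

/-- The polyline as a subset of the plane. -/
def trace (P : Polyline) : Set (ℝ × ℝ) := P.param '' Set.Icc 0 (P.shifts.length : ℝ)

/-- A closed polyline: the last vertex equals the first one. -/
def Closed (P : Polyline) : Prop := P.shifts.sum = 0

/-- A simple (open) polyline: edges may intersect only at a common vertex of
consecutive edges, i.e. the natural parameterization is injective. -/
def Simple (P : Polyline) : Prop := Set.InjOn P.param (Set.Icc 0 (P.shifts.length : ℝ))

/-- A simple closed polyline: closed and injective except for first = last point. -/
def SimpleClosed (P : Polyline) : Prop :=
  P.Closed ∧ Set.InjOn P.param (Set.Ico 0 (P.shifts.length : ℝ))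

/-- The `i`-th edge as a segment in the plane. -/
def edge (P : Polyline) (i : ℕ) : Set (ℝ × ℝ) := segment ℝ (P.vert i) (P.vert (i + 1))

/-- A polyline is in general position if all vertices are distinct, two edges meet
in at most one point which is either the common vertex of consecutive edges or lies
in the relative interiors of both, and no three edges have a common point. -/
def GeneralPosition (P : Polyline) : Prop :=
  (∀ i j, i < j → j ≤ P.shifts.length → P.vert i ≠ P.vert j) ∧
  (∀ i j, i < j → j < P.shifts.length →
    (P.edge i ∩ P.edge j).Subsingleton ∧
    ∀ x ∈ P.edge i ∩ P.edge j,
      (j = i + 1 ∧ x = P.vert j) ∨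
      (x ∈ openSegment ℝ (P.vert i) (P.vert (i + 1)) ∧
        x ∈ openSegment ℝ (P.vert j) (P.vert (j + 1)))) ∧
  ∀ i j k, i < j → j < k → k < P.shifts.length →
    P.edge i ∩ P.edge j ∩ P.edge k = ∅

end Polyline

/-- `P` is the (anticlockwise-oriented) closed simple boundary polyline of the
simple polygon `K`. -/
structure IsSimplePolygon (K : Set (ℝ × ℝ)) (P : Polyline) : Prop where
  compact : IsCompact K
  regular : K = closure (interior K)
  proper : P.Proper
  nonReverse : NonReverse (P.shifts ++ P.shifts.take 1)
  simpleClosed : P.SimpleClosed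
  boundary : frontier K = P.trace
  orient : rotClosed P.shifts = 2 * π

/-- The ray with apex `x` and direction `d`. -/
def ray (x d : ℝ × ℝ) : Set (ℝ × ℝ) := {y | ∃ t : ℝ, 0 ≤ t ∧ y = x + t • d}

/-- The angular region with apex `x` spanned by the directions `u` and `v` :
the convex hull of the two rays. Its angular measure is `|vangle u v|`. -/
def angularRegion (x u v : ℝ × ℝ) : Set (ℝ × ℝ) :=
  convexHull ℝ (ray x u ∪ ray x v)

/-- The merge of two shift sequences used in the sorted sum: repeatedly take the
head of the remaining sequence with the larger rotation (preferring the first). -/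
def sortedMerge : List (ℝ × ℝ) → List (ℝ × ℝ) → List (ℝ × ℝ)
  | [], t => t
  | s, [] => s
  | a :: s, b :: t =>
    if rotShifts (b :: t) ≤ rotShifts (a :: s) then a :: sortedMerge s (b :: t)
    else b :: sortedMerge (a :: s) t
termination_by s t => s.length + t.length

/-- The hypotheses of the sorted sum: both polylines are proper and non-reverse,
their first shifts have the same direction, and their rotations are equal. -/
def SortedSumHyp (P Q : Polyline) : Prop :=
  P.Proper ∧ Q.Proper ∧ NonReverse P.shifts ∧ NonReverse Q.shifts ∧
  vangle P.shifts.headI Q.shifts.headI = 0 ∧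
  rotShifts P.shifts = rotShifts Q.shifts

/-- The sorted sum `P +ₛ Q` : starts at the sum of the first vertices and has the
merged shift sequence. -/
def sortedSum (P Q : Polyline) : Polyline :=
  ⟨P.start + Q.start, sortedMerge P.shifts Q.shifts⟩


lemma xi_arg_div {u v : ℂ} (hu : u ≠ 0) (hv : v ≠ 0)
    (h : Complex.arg v - Complex.arg u ∈ Set.Ioc (-π) π) :
    Complex.arg (v / u) = Complex.arg v - Complex.arg u := by
  have h1 := Complex.arg_div_coe_angle hv hu
  rw [← Real.Angle.coe_sub] at h1
  rw [← Complex.arg_coe_angle_toReal_eq_arg, h1, Real.Angle.toReal_coe_eq_self_iff_mem_Ioc.2 h]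

lemma xi_arg_div_re {u v : ℂ} (hu : 0 < u.re) (hv : 0 < v.re) :
    Complex.arg (v / u) = Complex.arg v - Complex.arg u := by
  have h1 := abs_lt.1 (Complex.abs_arg_lt_pi_div_two_iff.2 (Or.inl hu))
  have h2 := abs_lt.1 (Complex.abs_arg_lt_pi_div_two_iff.2 (Or.inl hv))
  apply xi_arg_div
  · rintro rfl; simp at hu
  · rintro rfl; simp at hv
  · constructor <;> linarith [h1.1, h1.2, h2.1, h2.2]

lemma xi_sin_sub (u v : ℂ) :
    ‖u‖ * ‖v‖ * Real.sin (Complex.arg v - Complex.arg u) = v.im * u.re - v.re * u.im := by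
  rw [Real.sin_sub]
  have h1 := Complex.norm_mul_cos_arg u
  have h2 := Complex.norm_mul_sin_arg u
  have h3 := Complex.norm_mul_cos_arg v
  have h4 := Complex.norm_mul_sin_arg v
  rw [← h1, ← h2, ← h3, ← h4]; ring

lemma xi_arg_pos {v : ℂ} (h : 0 < Complex.arg v) (h' : Complex.arg v < π) : 0 < v.im := by
  have h1 := Complex.norm_mul_sin_arg v
  have : v ≠ 0 := by rintro rfl; simp at h
  rw [← h1]
  exact mul_pos (norm_pos_iff.2 this) (Real.sin_pos_of_pos_of_lt_pi h h')

lemma xi_seg_aux {u v : ℂ}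
    (h : ∀ t : ℝ, 0 ≤ t → t ≤ 1 → u + t * (v - u) ∈ Complex.slitPlane) :
    Complex.arg v - Complex.arg u < π := by
  by_contra hc
  push Not at hc
  have hv : v ∈ Complex.slitPlane := by simpa using h 1 (by norm_num) le_rfl
  have hvp := (Complex.mem_slitPlane_iff_arg.1 hv).1
  have h1 := Complex.arg_le_pi v
  have h2 := Complex.neg_pi_lt_arg u
  have hv1 : Complex.arg v < π := lt_of_le_of_ne h1 hvp
  have hu1 : u.im < 0 := Complex.arg_neg_iff.1 (by linarith)
  have hv2 : 0 < v.im := xi_arg_pos (by linarith) hv1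
  have hpos : 0 < v.im - u.im := by linarith
  have h3 := h (-u.im / (v.im - u.im)) (by apply div_nonneg <;> linarith)
    (by rw [div_le_one hpos]; linarith)
  rw [Complex.mem_slitPlane_iff] at h3
  simp only [Complex.add_re, Complex.mul_re, Complex.ofReal_re, Complex.sub_re, Complex.ofReal_im,
    Complex.add_im, Complex.mul_im, Complex.sub_im] at h3
  have h4 : u.im + ((-u.im / (v.im - u.im)) * (v.im - u.im) + 0 * (v.re - u.re)) = 0 := by
    field_simp; ring
  rcases h3 with h3 | h3
  · have h5 : 0 < v.im * u.re - v.re * u.im := by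
      have := mul_pos h3 hpos
      have e : (u.re + ((-u.im / (v.im - u.im)) * (v.re - u.re) - 0 * (v.im - u.im))) * (v.im - u.im)
        = v.im * u.re - v.re * u.im := by field_simp; ring
      linarith
    rw [← xi_sin_sub] at h5
    have h6 : Real.sin (Complex.arg v - Complex.arg u) ≤ 0 := by
      have : 0 ≤ Real.sin (Complex.arg v - Complex.arg u - π) :=
        Real.sin_nonneg_of_nonneg_of_le_pi (by linarith) (by linarith)
      rw [Real.sin_sub_pi] at this; linarith
    have := mul_nonneg (norm_nonneg u) (norm_nonneg v)
    nlinarith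
  · exact h3 h4

lemma xi_seg {u v : ℂ}
    (h : ∀ t : ℝ, 0 ≤ t → t ≤ 1 → u + t * (v - u) ∈ Complex.slitPlane) :
    Complex.arg (v / u) = Complex.arg v - Complex.arg u := by
  have hu : u ∈ Complex.slitPlane := by simpa using h 0 le_rfl (by norm_num)
  have hv : v ∈ Complex.slitPlane := by simpa using h 1 (by norm_num) le_rfl
  apply xi_arg_div (Complex.slitPlane_ne_zero hu) (Complex.slitPlane_ne_zero hv)
  have h1 := xi_seg_aux h
  have h2 := xi_seg_aux (u := v) (v := u) (fun t h0 h1 => by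
    have := h (1 - t) (by linarith) (by linarith)
    convert this using 1
    push_cast; ring)
  exact ⟨by linarith, h1.le⟩

/-- nonnegative combination of `1` and `w` with `arg w` in `[0,π)` or so -/
lemma xi_cone {w : ℂ} (hw : 0 ≤ Complex.arg w) (hw' : w ≠ 0) {a b : ℝ} (ha : 0 ≤ a) (hb : 0 ≤ b)
    (hne : (a + b * w : ℂ) ≠ 0) :
    0 ≤ Complex.arg (a + b * w) ∧ (Complex.arg w ≤ 0 ∨ Complex.arg (a + b * w) ≤ Complex.arg w) := by
  have him : 0 ≤ w.im := Complex.arg_nonneg_iff.1 hw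
  have h1 : 0 ≤ Complex.arg (a + b * w) := by
    rw [Complex.arg_nonneg_iff]; simp; positivity
  refine ⟨h1, ?_⟩
  by_contra hc
  push Not at hc
  obtain ⟨hc1, hc2⟩ := hc
  have h2 := xi_sin_sub (a + b * w) w
  have h3 : Real.sin (Complex.arg w - Complex.arg (a + b * w)) < 0 :=
    Real.sin_neg_of_neg_of_neg_pi_lt (by linarith) (by linarith [Complex.arg_le_pi (a + b * w)])
  have h4 : 0 < ‖(a + b * w : ℂ)‖ * ‖w‖ := mul_pos (norm_pos_iff.2 hne) (norm_pos_iff.2 hw')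
  have h5 : w.im * (a + b * w : ℂ).re - w.re * (a + b * w : ℂ).im = a * w.im := by
    simp; ring
  rw [h5] at h2
  have := mul_nonneg ha him
  nlinarith

lemma xi_edge_arg {c : ℂ} (hc : ∀ t : ℝ, 0 ≤ t → t ≤ 1 → 1 + t * c ≠ 0) {t : ℝ} (h0 : 0 ≤ t)
    (h1 : t ≤ 1) : 1 + t * c ∈ Complex.slitPlane := by
  rw [Complex.mem_slitPlane_iff]
  by_contra hcon
  push Not at hcon
  simp at hcon
  obtain ⟨h2, h3⟩ := hcon
  have ht : 0 < t := by
    rcases h0.eq_or_lt with h | h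
    · subst h; norm_num at h2
    · exact h
  have h3 : c.im = 0 := by rcases h3 with h | h; exact absurd h ht.ne'; exact h
  have hcr : c.re < 0 := by nlinarith
  apply hc (-1 / c.re) (div_nonneg_of_nonpos (by norm_num) hcr.le)
    (by rw [div_le_one_of_neg hcr]; nlinarith)
  apply Complex.ext
  · have := hcr.ne
    simp; field_simp; ring
  · simp [h3]

lemma xi_edge_between {c : ℂ} (hc : ∀ t : ℝ, 0 ≤ t → t ≤ 1 → 1 + t * c ≠ 0) {t : ℝ} (h0 : 0 ≤ t)
    (h1 : t ≤ 1) : min 0 (Complex.arg (1 + c)) ≤ Complex.arg (1 + t * c) ∧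
      Complex.arg (1 + t * c) ≤ max 0 (Complex.arg (1 + c)) := by
  have hw : (1 + c) ∈ Complex.slitPlane := by
    simpa using xi_edge_arg hc (t := 1) (by norm_num) le_rfl
  have key : ∀ w : ℂ, w ∈ Complex.slitPlane → 0 ≤ Complex.arg w → (1 + t * (w - 1)) ≠ 0 →
      0 ≤ Complex.arg (1 + t * (w - 1)) ∧ Complex.arg (1 + t * (w - 1)) ≤ Complex.arg w := by
    intro w hw hw0 hne
    have e : (1 + t * (w - 1)) = (((1 - t : ℝ)) + t * w : ℂ) := by push_cast; ring
    rw [e] at hne ⊢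
    have := xi_cone hw0 (Complex.slitPlane_ne_zero hw) (a := 1 - t) (b := t) (by linarith) h0 hne
    refine ⟨this.1, ?_⟩
    rcases this.2 with h | h
    · have h' : Complex.arg w = 0 := le_antisymm h hw0
      rw [h']
      have h2 := Complex.arg_eq_zero_iff.1 h'
      apply le_of_eq
      rw [Complex.arg_eq_zero_iff]
      have : 0 ≤ t * w.re := mul_nonneg h0 h2.1
      simp [h2.2]; linarith
    · exact h
  rcases le_total 0 (Complex.arg (1 + c)) with h | h
  · have := key (1 + c) hw h (by simpa using hc t h0 h1)
    rw [min_eq_left h, max_eq_right h]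
    simpa using this
  · rw [min_eq_right h, max_eq_left h]
    have hs := xi_edge_arg hc h0 h1
    have e1 := Complex.arg_conj (1 + c)
    rw [if_neg (Complex.mem_slitPlane_iff_arg.1 hw).1] at e1
    have e2 := Complex.arg_conj (1 + t * c)
    rw [if_neg (Complex.mem_slitPlane_iff_arg.1 hs).1] at e2
    have hcj : (starRingEnd ℂ) (1 + c) ∈ Complex.slitPlane := by
      rw [Complex.mem_slitPlane_iff] at hw ⊢; simpa using hw
    have e3 : (starRingEnd ℂ) (1 + t * c) = 1 + t * ((starRingEnd ℂ) (1 + c) - 1) := by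
      simp
    have := key _ hcj (by linarith) (by
      rw [← e3]; exact (map_ne_zero _).2 (Complex.slitPlane_ne_zero hs))
    rw [← e3, e1, e2] at this
    constructor <;> linarith [this.1, this.2]

/-- Args are additive on pairs in a common open half plane. -/
lemma xi_half {c u v : ℂ} (hu : 0 < (c * u).re) (hv : 0 < (c * v).re) :
    Complex.arg (v / u) = Complex.arg (c * v) - Complex.arg (c * u) := by
  have hc : c ≠ 0 := by rintro rfl; simp at hu
  rw [← xi_arg_div_re hu hv, mul_div_mul_left _ _ hc]

lemma xi_functional (f : ℂ →L[ℝ] ℝ) : ∃ c : ℂ, ∀ w, f w = (c * w).re := by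
  refine ⟨f 1 - f Complex.I * Complex.I, fun w => ?_⟩
  have : w = w.re • (1 : ℂ) + w.im • Complex.I := by
    apply Complex.ext <;> simp
  conv_lhs => rw [this]
  rw [map_add, map_smul, map_smul]
  simp; ring

lemma xi_square {p p' q q' : ℂ} (h : Disjoint (segment ℝ p p') (segment ℝ q q')) :
    Complex.arg ((q' - p) / (q - p)) + Complex.arg ((q' - p') / (q' - p)) =
    Complex.arg ((q - p') / (q - p)) + Complex.arg ((q' - p') / (q - p')) := by
  have hcomp : ∀ a b : ℂ, IsCompact (segment ℝ a b) := by
    intro a b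
    rw [← convexHull_pair]
    exact (Set.toFinite _).isCompact_convexHull ℝ
  obtain ⟨f, u, v, h1, h2, h3⟩ := geometric_hahn_banach_compact_closed (convex_segment p p')
    (hcomp p p') (convex_segment q q') (hcomp q q').isClosed h
  obtain ⟨c, hc⟩ := xi_functional f
  have k : ∀ a ∈ segment ℝ p p', ∀ b ∈ segment ℝ q q', 0 < (c * (b - a)).re := by
    intro a ha b hb
    rw [← hc, map_sub]
    linarith [h1 a ha, h3 b hb]
  have lp := left_mem_segment ℝ p p'
  have rp := right_mem_segment ℝ p p'
  have lq := left_mem_segment ℝ q q'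
  have rq := right_mem_segment ℝ q q'
  rw [xi_half (k _ lp _ lq) (k _ lp _ rq), xi_half (k _ lp _ rq) (k _ rp _ rq),
    xi_half (k _ lp _ lq) (k _ rp _ lq), xi_half (k _ rp _ lq) (k _ rp _ rq)]
  ring

lemma xi_slit_of_nonopp {s t : ℂ} (hs : s ≠ 0) (ht : t ≠ 0) (h : ∀ a : ℝ, a < 0 → t ≠ a * s) :
    t / s ∈ Complex.slitPlane := by
  rw [Complex.mem_slitPlane_iff]
  by_contra hcon
  push Not at hcon
  have e : t / s = ((t / s).re : ℂ) := by
    apply Complex.ext <;> simp [hcon.2]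
  rcases hcon.1.eq_or_lt with h1 | h1
  · rw [h1] at e
    have := div_ne_zero ht hs
    simp at e; tauto
  · exact h _ h1 (by rw [← e]; field_simp)

lemma xi_tri {s t : ℂ} (hs : s ≠ 0) (ht : t ≠ 0) (h : ∀ a : ℝ, a < 0 → t ≠ a * s) :
    Complex.arg ((s + t) / s) + Complex.arg (t / (s + t)) = Complex.arg (t / s) := by
  have hw := xi_slit_of_nonopp hs ht h
  set w := t / s with hwd
  have e1 : (s + t) / s = 1 + w := by rw [hwd]; field_simp
  have hts : t = w * s := by rw [hwd]; field_simp
  have e2 : t / (s + t) = w / (1 + w) := by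
    rw [hts, show s + w * s = (1 + w) * s by ring, mul_div_mul_right _ _ hs]
  rw [e1, e2, xi_seg (u := 1 + w) (v := w)]
  · ring
  · intro x h0 h1
    rw [Complex.mem_slitPlane_iff] at hw ⊢
    simp
    rcases hw with hw | hw
    · by_cases hh : w.im = 0
      · left; nlinarith
      · right; exact hh
    · right; exact hw

/-- Discrete version of the Hopf secant argument. -/
lemma xi_hopf (z : ℕ → ℂ) (N : ℕ)
    (hdis : ∀ i j, i + 1 < j → j < N →
      Disjoint (segment ℝ (z i) (z (i+1))) (segment ℝ (z j) (z (j+1))))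
    (hne : ∀ i, i < N → z (i+1) - z i ≠ 0)
    (hopp : ∀ i, i + 1 < N → ∀ a : ℝ, a < 0 → z (i+2) - z (i+1) ≠ a * (z (i+1) - z i)) :
    ∀ b, b + 1 ≤ N →
    ∑ i ∈ Finset.range b, Complex.arg ((z (i+2) - z (i+1)) / (z (i+1) - z i)) =
    ∑ j ∈ Finset.range b, Complex.arg ((z (j+2) - z 0) / (z (j+1) - z 0)) +
    ∑ i ∈ Finset.range b, Complex.arg ((z (b+1) - z (i+1)) / (z (b+1) - z i)) := by
  intro b
  induction b with
  | zero => simp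
  | succ b ih =>
    intro hb
    have ih := ih (by omega)
    rw [Finset.sum_range_succ, ih, Finset.sum_range_succ, Finset.sum_range_succ]
    have hsq : ∀ i ∈ Finset.range b,
        Complex.arg ((z (b+2) - z (i+1)) / (z (b+2) - z i)) =
        Complex.arg ((z (b+1) - z (i+1)) / (z (b+1) - z i)) +
        (Complex.arg ((z (b+2) - z (i+1)) / (z (b+1) - z (i+1))) -
         Complex.arg ((z (b+2) - z i) / (z (b+1) - z i))) := by
      intro i hi
      have hi := Finset.mem_range.1 hi
      have := xi_square (hdis i (b+1) (by omega) (by omega))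
      linarith
    rw [show b + 1 + 1 = b + 2 from rfl, Finset.sum_congr rfl hsq, Finset.sum_add_distrib,
      Finset.sum_range_sub (fun i => Complex.arg ((z (b+2) - z i) / (z (b+1) - z i)))]
    have ht := xi_tri (hne b (by omega)) (hne (b+1) (by omega)) (hopp b (by omega))
    have e : z (b+1) - z b + (z (b+1+1) - z (b+1)) = z (b+2) - z b := by
      rw [show b + 1 + 1 = b + 2 from rfl]; ring
    rw [e] at ht
    rw [← show b + 1 + 1 = b + 2 from rfl] at *
    linarith

lemma xi_final {q : ℂ} {β : ℝ} (h0 : 0 ≤ β) (h1 : β < π) {ρ : ℝ} (hρ : 0 < ρ)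
    (hq : q = -(ρ * Complex.exp (-(β * Complex.I)))) :
    Complex.arg (1 - q) - Complex.arg (1 - 1 / q) = - β := by
  set e := Complex.exp (-(β * Complex.I)) with he
  have hee : e = Complex.cos (β:ℝ) - Complex.sin (β:ℝ) * Complex.I := by
    rw [he, show -(β * Complex.I) = (-β : ℂ) * Complex.I by ring, Complex.exp_mul_I,
      Complex.cos_neg, Complex.sin_neg]
    ring
  have hre : e.re = Real.cos β := by rw [hee]; simp [Complex.cos_ofReal_re, Complex.sin_ofReal_im]
  have him : e.im = - Real.sin β := by rw [hee]; simp [Complex.sin_ofReal_re, Complex.cos_ofReal_im]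
  have hene : e ≠ 0 := Complex.exp_ne_zero _
  have harge : Complex.arg e = - β := by
    rw [he, show -(β * Complex.I) = ((-β : ℝ) : ℂ) * Complex.I by push_cast; ring]
    rw [Complex.arg_exp_mul_I, toIocMod_eq_self]
    constructor <;> linarith
  have hρc : (ρ : ℂ) ≠ 0 := by exact_mod_cast hρ.ne'
  have hqne : q ≠ 0 := by rw [hq]; exact neg_ne_zero.2 (mul_ne_zero hρc hene)
  have hsin := Real.sin_nonneg_of_nonneg_of_le_pi h0 h1.le
  have hnz : 1 - q ≠ 0 := by
    intro h
    have hr := congrArg Complex.re h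
    have hi := congrArg Complex.im h
    rw [hq] at hr hi
    simp [hre, him] at hr hi
    have hsb : Real.sin β = 0 := by rcases hi with h | h; exact absurd h hρ.ne'; exact h
    have hb0 : β = 0 := by
      by_contra hne
      exact absurd hsb (Real.sin_pos_of_pos_of_lt_pi (lt_of_le_of_ne h0 (Ne.symm hne)) h1).ne'
    rw [hb0] at hr; simp at hr; linarith
  have hq2 : 1 - 1 / q = (1 - q) / (ρ * e) := by
    have : (ρ * e : ℂ) = - q := by rw [hq]; ring
    rw [this]; field_simp; ring
  have hargre : Complex.arg (ρ * e) = -β := by rw [Complex.arg_real_mul _ hρ, harge]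
  have him1 : (1 - q).im ≤ 0 := by rw [hq]; simp [him]; positivity
  -- arg (1-q) ∈ [-β, 0]
  have hb : Complex.arg (1 - q) ≤ 0 ∧ -β ≤ Complex.arg (1 - q) := by
    have h2 : 0 ≤ (1-q).im ∨ (1-q).im < 0 := le_or_gt _ _
    rcases h2 with h2 | h2
    · have h3 : (1-q).im = 0 := le_antisymm him1 h2
      have h4 : 0 ≤ (1-q).re := by
        have hi := h3
        rw [hq] at hi ⊢
        simp [hre, him] at hi ⊢
        have hsb : Real.sin β = 0 := by rcases hi with h | h; exact absurd h hρ.ne'; exact h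
        have hb0 : β = 0 := by
          by_contra hne
          exact absurd hsb (Real.sin_pos_of_pos_of_lt_pi (lt_of_le_of_ne h0 (Ne.symm hne)) h1).ne'
        rw [hb0]; simp; linarith
      rw [Complex.arg_eq_zero_iff.2 ⟨h4, h3⟩]
      exact ⟨le_rfl, by linarith⟩
    · have h3 := Complex.arg_neg_iff.2 h2
      refine ⟨h3.le, ?_⟩
      by_contra hc
      push Not at hc
      have h5 := xi_sin_sub (1 - q) (ρ * e)
      rw [hargre] at h5
      have h6 : 0 < Real.sin (-β - Complex.arg (1-q)) :=
        Real.sin_pos_of_pos_of_lt_pi (by linarith) (by linarith [Complex.neg_pi_lt_arg (1-q)])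
      have h7 : ((ρ * e : ℂ)).im * (1-q).re - (ρ * e : ℂ).re * (1-q).im = - (ρ * Real.sin β) := by
        rw [hq]; simp [hre, him]; ring
      rw [h7] at h5
      have := mul_pos (mul_pos (norm_pos_iff.2 hnz) (norm_pos_iff.2 (mul_ne_zero hρc hene))) h6
      have := mul_nonneg hρ.le hsin
      linarith
  rw [hq2, xi_arg_div (mul_ne_zero hρc hene) hnz, hargre]
  · ring
  · rw [hargre]; constructor <;> linarith [hb.1, hb.2]

lemma xi_not_slit_one_sub {w : ℂ} (h : ¬ (w.im = 0 ∧ 0 < w.re)) : 1 - w ∈ Complex.slitPlane := by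
  rw [Complex.mem_slitPlane_iff]
  by_contra hc
  push Not at hc
  simp at hc
  exact h ⟨hc.2, by linarith⟩

/-- A quotient with lifted angle difference strictly between `0` and `2π` is not a positive real. -/
lemma xi_not_pos {a b : ℂ} {α γ : ℝ} (ha : a = ‖a‖ * Complex.exp (α * Complex.I))
    (hb : b = ‖b‖ * Complex.exp (γ * Complex.I)) (ha0 : a ≠ 0)
    (h1 : 0 < α - γ) (h2 : α - γ < 2 * π) : ∀ r : ℝ, 0 < r → a ≠ r * b := by
  intro r hr h
  have hn : ‖a‖ = r * ‖b‖ := by rw [h, norm_mul, Complex.norm_real, Real.norm_of_nonneg hr.le]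
  have hex : Complex.exp (α * Complex.I) = Complex.exp (γ * Complex.I) := by
    have h3 : (‖a‖ : ℂ) * Complex.exp (α * Complex.I) = ‖a‖ * Complex.exp (γ * Complex.I) := by
      rw [← ha, h]
      conv_lhs => rw [hb]
      rw [← h, hn]; push_cast; ring
    have : (‖a‖ : ℂ) ≠ 0 := by exact_mod_cast (norm_pos_iff.2 ha0).ne'
    exact mul_left_cancel₀ this h3
  rw [Complex.exp_eq_exp_iff_exists_int] at hex
  obtain ⟨n, hn⟩ := hex
  have h4 := congrArg Complex.im hn
  simp at h4
  have hn0 : (0:ℝ) < n := by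
    by_contra hc; push Not at hc
    nlinarith [Real.pi_pos]
  have hn1 : (n:ℝ) < 1 := by
    by_contra hc; push Not at hc
    nlinarith [Real.pi_pos]
  have a1 : (0:ℤ) < n := by exact_mod_cast hn0
  have a2 : n < (1:ℤ) := by exact_mod_cast hn1
  omega

lemma xi_polar_mul {a b : ℂ} {α : ℝ} (ha : a = ‖a‖ * Complex.exp (α * Complex.I)) (ha0 : a ≠ 0) :
    b = ‖b‖ * Complex.exp (((α + Complex.arg (b / a) : ℝ) : ℂ) * Complex.I) := by
  have h1 := Complex.norm_mul_exp_arg_mul_I (b / a)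
  have h2 : b = a * (b / a) := by field_simp
  have hn : (‖b‖ : ℂ) = ‖a‖ * ‖b / a‖ := by
    rw [norm_div]
    have : (‖a‖ : ℝ) ≠ 0 := (norm_pos_iff.2 ha0).ne'
    push_cast
    have : (‖a‖ : ℂ) ≠ 0 := by exact_mod_cast this
    field_simp
  push_cast
  rw [add_mul, Complex.exp_add, hn]
  have h3 : ‖a‖ * ‖b / a‖ * (Complex.exp (α * Complex.I) *
      Complex.exp (Complex.arg (b / a) * Complex.I)) = (‖a‖ * Complex.exp (α * Complex.I)) *
      (‖b / a‖ * Complex.exp (Complex.arg (b / a) * Complex.I)) := by ring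
  rw [h3, ← ha, h1]
  exact h2

lemma xi_edge_polar {a b : ℂ} {α : ℝ} (ha : a = ‖a‖ * Complex.exp (α * Complex.I))
    (hseg : ∀ t : ℝ, 0 ≤ t → t ≤ 1 → a + t * (b - a) ≠ 0) {t : ℝ} (h0 : 0 ≤ t) (h1 : t ≤ 1) :
    ∃ γ : ℝ, a + t * (b - a) = ‖a + t * (b - a)‖ * Complex.exp (γ * Complex.I) ∧
      min α (α + Complex.arg (b / a)) ≤ γ ∧ γ ≤ max α (α + Complex.arg (b / a)) := by
  have ha0 : a ≠ 0 := by simpa using hseg 0 le_rfl (by norm_num)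
  refine ⟨α + Complex.arg ((a + t * (b - a)) / a), xi_polar_mul ha ha0, ?_⟩
  have hc : ∀ t : ℝ, (a + t * (b - a)) / a = 1 + t * ((b - a) / a) := by
    intro t; field_simp
  have := xi_edge_between (c := (b - a) / a) (fun t h0 h1 => by
    rw [← hc]; exact div_ne_zero (hseg t h0 h1) ha0) h0 h1
  rw [← hc] at this
  have e : 1 + (b - a) / a = b / a := by field_simp; ring
  rw [e] at this
  obtain ⟨h2, h3⟩ := this
  constructor
  · have : min α (α + Complex.arg (b / a)) = α + min 0 (Complex.arg (b / a)) := by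
      rw [← min_add_add_left]; simp
    rw [this]; linarith
  · have : max α (α + Complex.arg (b / a)) = α + max 0 (Complex.arg (b / a)) := by
      rw [← max_add_add_left]; simp
    rw [this]; linarith

lemma xi_arc (z : ℕ → ℂ) (θ : ℕ → ℝ) (b : ℕ) (β : ℝ) (hβ0 : 0 ≤ β) (hβ1 : β < π)
    (hpol : ∀ j, j ≤ b + 1 → z j = ‖z j‖ * Complex.exp (θ j * Complex.I))
    (hedge : ∀ j, j < b + 1 → ∀ t : ℝ, 0 ≤ t → t ≤ 1 → z j + t * (z (j+1) - z j) ≠ 0)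
    (hθ : ∀ j, j < b + 1 → θ (j+1) = θ j + Complex.arg (z (j+1) / z j))
    (hlt : ∀ j, 0 < j → j ≤ b + 1 → θ j < θ 0)
    (hgt : ∀ j, j < b + 1 → θ (b+1) < θ j)
    (hend : θ (b+1) = θ 0 - (π + β))
    (hdis : ∀ i j, i + 1 < j → j < b + 1 →
      Disjoint (segment ℝ (z i) (z (i+1))) (segment ℝ (z j) (z (j+1))))
    (hne : ∀ i, i < b + 1 → z (i+1) - z i ≠ 0)
    (hopp : ∀ i, i + 1 < b + 1 → ∀ a : ℝ, a < 0 → z (i+2) - z (i+1) ≠ a * (z (i+1) - z i)) :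
    ∑ i ∈ Finset.range b, Complex.arg ((z (i+2) - z (i+1)) / (z (i+1) - z i)) < - β := by
  have hz0 : ∀ j, j ≤ b + 1 → z j ≠ 0 := by
    intro j hj
    rcases hj.lt_or_eq with h | h
    · simpa using hedge j h 0 le_rfl (by norm_num)
    · have := hedge b (by omega) 1 (by norm_num) le_rfl
      rw [h]; simpa using this
  rw [xi_hopf z (b+1) hdis hne hopp b le_rfl]
  have z0 := hz0 0 (by omega)
  have zN := hz0 (b+1) le_rfl
  -- points on edges
  have hfirst : ∀ j, j < b → ∀ t : ℝ, 0 ≤ t → t ≤ 1 →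
      1 - (z (j+1) + t * (z (j+2) - z (j+1))) / z 0 ∈ Complex.slitPlane := by
    intro j hj t h0 h1
    apply xi_not_slit_one_sub
    rintro ⟨hi, hr⟩
    have hs := hedge (j+1) (by omega)
    obtain ⟨γ, hγ, hmin, hmax⟩ := xi_edge_polar (hpol (j+1) (by omega)) hs h0 h1
    rw [← hθ (j+1) (by omega)] at hmin hmax
    have hγ0 : γ < θ 0 := lt_of_le_of_lt hmax
      (max_lt (hlt (j+1) (by omega) (by omega)) (hlt (j+2) (by omega) (by omega)))
    have hγ1 : θ (b+1) ≤ γ := by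
      refine le_trans (le_min (hgt (j+1) (by omega)).le ?_) hmin
      rcases (show j + 2 ≤ b + 1 by omega).lt_or_eq with h | h
      · exact (hgt (j+2) h).le
      · rw [← h]
    have hne' := hs t h0 h1
    set y := z (j+1) + t * (z (j+1+1) - z (j+1)) with hy
    have e : y / z 0 = ((y / z 0).re : ℂ) := Complex.ext (by simp) (by simpa using hi)
    apply xi_not_pos (hpol 0 (by omega)) hγ z0 (by linarith) (by linarith) ((y / z 0).re)⁻¹
      (inv_pos.2 hr)
    push_cast
    rw [← e]; field_simp
  have hsecond : ∀ j, j < b → ∀ t : ℝ, 0 ≤ t → t ≤ 1 →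
      1 - (z j + t * (z (j+1) - z j)) / z (b+1) ∈ Complex.slitPlane := by
    intro j hj t h0 h1
    apply xi_not_slit_one_sub
    rintro ⟨hi, hr⟩
    have hs := hedge j (by omega)
    obtain ⟨γ, hγ, hmin, hmax⟩ := xi_edge_polar (hpol j (by omega)) hs h0 h1
    rw [← hθ j (by omega)] at hmin hmax
    have hγ0 : γ ≤ θ 0 := by
      refine le_trans hmax (max_le ?_ (hlt (j+1) (by omega) (by omega)).le)
      rcases Nat.eq_zero_or_pos j with h | h
      · rw [h]
      · exact (hlt j h (by omega)).le
    have hγ1 : θ (b+1) < γ := 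
      lt_of_lt_of_le (lt_min (hgt j (by omega)) (hgt (j+1) (by omega))) hmin
    have hne' := hs t h0 h1
    set y := z j + t * (z (j+1) - z j) with hy
    have e : y / z (b+1) = ((y / z (b+1)).re : ℂ) := Complex.ext (by simp) (by simpa using hi)
    apply xi_not_pos hγ (hpol (b+1) le_rfl) hne' (by linarith) (by linarith) ((y / z (b+1)).re) hr
    rw [← e]; field_simp
  have hS1 : ∑ j ∈ Finset.range b, Complex.arg ((z (j+2) - z 0) / (z (j+1) - z 0)) =
      Complex.arg (1 - z (b+1) / z 0) - Complex.arg (1 - z 1 / z 0) := by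
    rw [← Finset.sum_range_sub (fun j => Complex.arg (1 - z (j+1) / z 0))]
    apply Finset.sum_congr rfl
    intro j hj
    have hj := Finset.mem_range.1 hj
    rw [← xi_seg]
    · congr 1
      have : ∀ w, 1 - w / z 0 = (w - z 0) / (- z 0) := by intro w; field_simp; ring
      rw [this, this, div_div_div_cancel_right₀ (neg_ne_zero.2 z0)]
    · intro t h0 h1
      convert hfirst j hj t h0 h1 using 1
      ring
  have hS2 : ∑ i ∈ Finset.range b, Complex.arg ((z (b+1) - z (i+1)) / (z (b+1) - z i)) =
      Complex.arg (1 - z b / z (b+1)) - Complex.arg (1 - z 0 / z (b+1)) := by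
    rw [← Finset.sum_range_sub (fun j => Complex.arg (1 - z j / z (b+1)))]
    apply Finset.sum_congr rfl
    intro j hj
    have hj := Finset.mem_range.1 hj
    rw [← xi_seg]
    · congr 1
      have : ∀ w, 1 - w / z (b+1) = (z (b+1) - w) / (z (b+1)) := by intro w; field_simp
      rw [this, this, div_div_div_cancel_right₀ zN]
    · intro t h0 h1
      convert hsecond j hj t h0 h1 using 1
      ring
  rw [hS1, hS2]
  have hA : 0 < Complex.arg (1 - z 1 / z 0) := by
    have h1 := hθ 0 (by omega)
    have h2 := hlt 1 (by omega) (by omega)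
    have h3 : (z 1 / z 0).im < 0 := Complex.arg_neg_iff.1 (by simp at h1; linarith)
    have h4 : 0 ≤ Complex.arg (1 - z 1 / z 0) := by rw [Complex.arg_nonneg_iff]; simp; linarith
    refine lt_of_le_of_ne h4 (fun h => ?_)
    have := (Complex.arg_eq_zero_iff.1 h.symm).2
    simp at this; linarith
  have hB : Complex.arg (1 - z b / z (b+1)) < 0 := by
    have h1 := hθ b (by omega)
    have h2 := hgt b (by omega)
    have h3 : (z (b+1) / z b).im < 0 := Complex.arg_neg_iff.1 (by linarith)
    rw [Complex.arg_neg_iff]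
    rw [← inv_div, Complex.sub_im, Complex.inv_im]
    have h4 : 0 < Complex.normSq (z (b+1) / z b) :=
      Complex.normSq_pos.2 (div_ne_zero zN (hz0 b (by omega)))
    have := div_pos (neg_pos.2 h3) h4
    simp only [Complex.one_im]; linarith
  have hq : z (b+1) / z 0 = -(((‖z (b+1)‖ / ‖z 0‖ : ℝ) : ℂ) * Complex.exp (-(β * Complex.I))) := by
    conv_lhs => rw [hpol (b+1) le_rfl, hpol 0 (by omega), hend]
    have n0 : (‖z 0‖ : ℂ) ≠ 0 := by exact_mod_cast (norm_pos_iff.2 z0).ne'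
    have : ((θ 0 - (π + β) : ℝ) : ℂ) * Complex.I = θ 0 * Complex.I + -(β * Complex.I) - π * Complex.I := by
      push_cast; ring
    rw [this, Complex.exp_sub, Complex.exp_pi_mul_I, Complex.exp_add]
    have := Complex.exp_ne_zero (θ 0 * Complex.I)
    push_cast
    field_simp
  have := xi_final hβ0 hβ1 (div_pos (norm_pos_iff.2 zN) (norm_pos_iff.2 z0)) hq
  rw [one_div_div] at this
  linarith

structure XiPoly (K : Set ℂ) (n : ℕ) (V : ℕ → ℂ) : Prop where
  hn : 0 < n
  compact : IsCompact K
  regular : K = closure (interior K)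
  per : ∀ i, V (i + n) = V i
  ne : ∀ i, V (i+1) - V i ≠ 0
  opp : ∀ i, ∀ a : ℝ, a < 0 → V (i+2) - V (i+1) ≠ a * (V (i+1) - V i)
  simp : ∀ i j : ℕ, ∀ t t' : ℝ, 0 ≤ t → t < 1 → 0 ≤ t' → t' < 1 →
    V i + t * (V (i+1) - V i) = V j + t' * (V (j+1) - V j) → i ≡ j [MOD n] ∧ t = t'
  bd : frontier K = {y | ∃ i : ℕ, i < n ∧ ∃ t : ℝ, 0 ≤ t ∧ t ≤ 1 ∧ y = V i + t * (V (i+1) - V i)}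

def xicr (s y : ℂ) : ℝ := s.re * y.im - s.im * y.re

lemma xicr_cont (s v : ℂ) : Continuous (fun y : ℂ => xicr s (y - v)) := by
  unfold xicr
  fun_prop

lemma xicr_lin (s y w : ℂ) (a : ℝ) : xicr s (y + a * w) = xicr s y + a * xicr s w := by
  unfold xicr; simp; ring

lemma xicr_self (s : ℂ) (a : ℝ) : xicr s (a * s) = 0 := by unfold xicr; simp; ring

namespace XiPoly
variable {K : Set ℂ} {n : ℕ} {V : ℕ → ℂ}

lemma mod_eq (h : XiPoly K n V) {i j : ℕ} (hij : i ≡ j [MOD n]) : V i = V j := by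
  have hp : Function.Periodic V n := h.per
  have e1 := hp.map_mod_nat i
  have e2 := hp.map_mod_nat j
  rw [← e1, ← e2, hij]

lemma bd' (h : XiPoly K n V) (i : ℕ) {t : ℝ} (h0 : 0 ≤ t) (h1 : t ≤ 1) :
    V i + t * (V (i+1) - V i) ∈ frontier K := by
  rw [h.bd]
  refine ⟨i % n, Nat.mod_lt _ h.hn, t, h0, h1, ?_⟩
  rw [h.mod_eq (Nat.mod_modEq i n), h.mod_eq (Nat.ModEq.add_right 1 (Nat.mod_modEq i n))]

lemma simp' (h : XiPoly K n V) {i j : ℕ} {t t' : ℝ} (h0 : 0 ≤ t) (h1 : t < 1) (h0' : 0 ≤ t')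
    (h1' : t' ≤ 1) (he : V i + t * (V (i+1) - V i) = V j + t' * (V (j+1) - V j)) :
    (i ≡ j [MOD n] ∧ t = t') ∨ (t = 0 ∧ i ≡ j + 1 [MOD n]) := by
  rcases h1'.lt_or_eq with h2 | h2
  · exact Or.inl (h.simp i j t t' h0 h1 h0' h2 he)
  · right
    have := h.simp i (j+1) t 0 h0 h1 le_rfl (by norm_num) (by rw [he, h2]; simp)
    exact ⟨this.2, this.1⟩

def edgeSet (V : ℕ → ℂ) (i : ℕ) : Set ℂ :=
  {y | ∃ t : ℝ, 0 ≤ t ∧ t ≤ 1 ∧ y = V i + t * (V (i+1) - V i)}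

lemma edgeSet_closed (V : ℕ → ℂ) (i : ℕ) : IsClosed (edgeSet V i) := by
  have : edgeSet V i = (fun t : ℝ => V i + t * (V (i+1) - V i)) '' Set.Icc 0 1 := by
    ext y; constructor
    · rintro ⟨t, h0, h1, rfl⟩; exact ⟨t, ⟨h0, h1⟩, rfl⟩
    · rintro ⟨t, ⟨h0, h1⟩, rfl⟩; exact ⟨t, h0, h1, rfl⟩
  rw [this]
  apply IsCompact.isClosed
  apply isCompact_Icc.image
  fun_prop

lemma near (h : XiPoly K n V) (q : ℂ) :
    ∀ᶠ y in nhds q, y ∈ frontier K → ∃ j, j < n ∧ q ∈ edgeSet V j ∧ y ∈ edgeSet V j := by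
  have : ∀ j ∈ Finset.range n, ∀ᶠ y in nhds q, y ∈ edgeSet V j → q ∈ edgeSet V j := by
    intro j _
    by_cases hq : q ∈ edgeSet V j
    · exact Filter.Eventually.of_forall fun _ _ => hq
    · filter_upwards [(edgeSet_closed V j).isOpen_compl.mem_nhds hq] with y hy hy'
      exact absurd hy' hy
  have := (Filter.eventually_all_finset (Finset.range n)).2 this
  filter_upwards [this] with y hy hyT
  rw [h.bd] at hyT
  obtain ⟨i, hi, t, h0, h1, he⟩ := hyT
  exact ⟨i, hi, hy i (Finset.mem_range.2 hi) ⟨t, h0, h1, he⟩, ⟨t, h0, h1, he⟩⟩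

lemma cr_edge {i : ℕ} {y : ℂ} (hy : y ∈ edgeSet V i) : xicr (V (i+1) - V i) (y - V i) = 0 := by
  obtain ⟨t, _, _, rfl⟩ := hy
  rw [add_sub_cancel_left, xicr_self]

lemma near_int (h : XiPoly K n V) (i : ℕ) {t : ℝ} (h0 : 0 < t) (h1 : t < 1) :
    ∀ᶠ y in nhds (V i + t * (V (i+1) - V i)), y ∈ frontier K →
      xicr (V (i+1) - V i) (y - V i) = 0 := by
  filter_upwards [h.near (V i + t * (V (i+1) - V i))] with y hy hyT
  obtain ⟨j, hj, ⟨t', h0', h1', he⟩, hyj⟩ := hy hyT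
  have := cr_edge hyj
  rcases h.simp' h0.le h1 h0' h1' he with h2 | h2
  · rwa [h.mod_eq h2.1, h.mod_eq (Nat.ModEq.add_right 1 h2.1)]
  · exact absurd h2.1 h0.ne'

lemma near_vert (h : XiPoly K n V) (i : ℕ) :
    ∀ᶠ y in nhds (V (i+1)), y ∈ frontier K →
      xicr (V (i+1) - V i) (y - V (i+1)) = 0 ∨ xicr (V (i+2) - V (i+1)) (y - V (i+1)) = 0 := by
  filter_upwards [h.near (V (i+1))] with y hy hyT
  obtain ⟨j, hj, ⟨t', h0', h1', he⟩, hyj⟩ := hy hyT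
  have := cr_edge hyj
  have he' : V (i+1) + (0:ℝ) * (V (i+1+1) - V (i+1)) = V j + t' * (V (j+1) - V j) := by
    rw [← he]; simp
  rcases h.simp' le_rfl (by norm_num) h0' h1' he' with h2 | h2
  · right
    have e := h.mod_eq (Nat.ModEq.add_right 1 h2.1)
    rw [h.mod_eq h2.1]
    rwa [show i + 2 = i + 1 + 1 from rfl, e]
  · left
    have e1 : i ≡ j [MOD n] := Nat.ModEq.add_right_cancel' 1 h2.2
    rw [h.mod_eq h2.2, h.mod_eq e1]
    have e3 : y - V j = (y - V (j+1)) + (1:ℝ) * (V (j+1) - V j) := by simp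
    have e2 := xicr_self (V (j+1) - V j) 1
    simp only [Complex.ofReal_one, one_mul] at e2
    rw [e3, xicr_lin, e2] at this
    simpa using this

lemma const_of_convex {W : Set ℂ} (hW : Convex ℝ W)
    (hT : ∀ y ∈ W, y ∉ frontier K) : (∀ y ∈ W, y ∈ K) ∨ (∀ y ∈ W, y ∉ K) := by
  by_contra hc
  push Not at hc
  obtain ⟨⟨a, ha, haK⟩, ⟨b, hb, hbK⟩⟩ := hc
  have hin : ∀ y ∈ W, y ∈ K → y ∈ interior K := by
    intro y hy hyK
    by_contra hn
    exact hT y hy ⟨subset_closure hyK, hn⟩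
  have hout : ∀ y ∈ W, y ∉ K → y ∈ (closure K)ᶜ := by
    intro y hy hyK hn
    exact hT y hy ⟨hn, fun hi => hyK (interior_subset hi)⟩
  obtain ⟨y, hy, hy1, hy2⟩ := hW.isPreconnected (interior K) (closure K)ᶜ isOpen_interior
    isClosed_closure.isOpen_compl (fun y hy => by
      by_cases hyK : y ∈ K
      · exact Or.inl (hin y hy hyK)
      · exact Or.inr (hout y hy hyK)) ⟨b, hb, hin b hb hbK⟩ ⟨a, ha, hout a ha haK⟩
  exact hy2 (subset_closure (interior_subset hy1))

def Side (K : Set ℂ) (V : ℕ → ℂ) (i : ℕ) (σ : ℝ) (q : ℂ) : Prop :=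
  ∀ᶠ y in nhds q, (0 < σ * xicr (V (i+1) - V i) (y - V i) → y ∈ K) ∧
    (σ * xicr (V (i+1) - V i) (y - V i) < 0 → y ∉ K)

lemma half_convex (B : Set ℂ) (hB : Convex ℝ B) (s v : ℂ) (τ : ℝ) :
    Convex ℝ {y | y ∈ B ∧ 0 < τ * xicr s (y - v)} := by
  intro a ha b hb x y hx hy hxy
  refine ⟨hB ha.1 hb.1 hx hy hxy, ?_⟩
  have e : τ * xicr s (x • a + y • b - v) = x * (τ * xicr s (a - v)) + y * (τ * xicr s (b - v)) := by
    have : y = 1 - x := by linarith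
    subst this
    unfold xicr; simp; ring
  rw [e]
  have h1 := ha.2
  have h2 := hb.2
  rcases hx.eq_or_lt with h | h
  · have : y = 1 := by linarith
    rw [← h, this]; linarith
  · have := mul_pos h h1
    have := mul_nonneg hy h2.le
    linarith

/-- moving off a line in a nonempty open set -/
lemma off_line {s v q ν : ℂ} {B : Set ℂ} (hB : B ∈ nhds q) (τ : ℝ)
    (hν : 0 < xicr s ν) (hq : xicr s (q - v) = 0) (hτ : 0 < τ * τ) :
    ∃ y ∈ B, 0 < τ * xicr s (y - v) := by
  have ht : Filter.Tendsto (fun η : ℝ => q + (η * τ : ℝ) * ν) (nhds 0) (nhds q) := by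
    have : Continuous (fun η : ℝ => q + (η * τ : ℝ) * ν) := by fun_prop
    simpa using this.tendsto 0
  have h1 : ∀ᶠ η in nhdsWithin (0:ℝ) (Set.Ioi 0), q + (η * τ : ℝ) * ν ∈ B :=
    (ht.mono_left nhdsWithin_le_nhds) hB
  obtain ⟨η, hη, hη0⟩ := (h1.and self_mem_nhdsWithin).exists
  refine ⟨_, hη, ?_⟩
  rw [show q + (η * τ : ℝ) * ν - v = (q - v) + (η * τ : ℝ) * ν by ring, xicr_lin, hq]
  have : 0 < η * (τ * τ) * xicr s ν := mul_pos (mul_pos hη0 hτ) hν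
  nlinarith

lemma normal_pos {s : ℂ} (hs : s ≠ 0) : 0 < xicr s (Complex.I * s) := by
  have := Complex.normSq_pos.2 hs
  rw [Complex.normSq_apply] at this
  unfold xicr; simp; linarith

lemma side_exists (h : XiPoly K n V) (i : ℕ) {t : ℝ} (h0 : 0 < t) (h1 : t < 1) :
    Side K V i 1 (V i + t * (V (i+1) - V i)) ∨ Side K V i (-1) (V i + t * (V (i+1) - V i)) := by
  set s := V (i+1) - V i with hs
  set q := V i + t * s with hq
  obtain ⟨ε, hε, hB⟩ := Metric.eventually_nhds_iff_ball.1 (h.near_int i h0 h1)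
  rw [← hs, ← hq] at hB
  have hBn := Metric.ball_mem_nhds q hε
  have hcst : ∀ τ : ℝ, (∀ y ∈ {y | y ∈ Metric.ball q ε ∧ 0 < τ * xicr s (y - V i)}, y ∈ K) ∨
      (∀ y ∈ {y | y ∈ Metric.ball q ε ∧ 0 < τ * xicr s (y - V i)}, y ∉ K) := by
    intro τ
    apply const_of_convex (half_convex _ (convex_ball _ _) _ _ _)
    rintro y ⟨hy, hy2⟩ hyT
    rw [hB y hy hyT] at hy2; simp at hy2
  have hqT : q ∈ frontier K := h.bd' i h0.le h1.le
  have hclosed := h.compact.isClosed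
  have hsn : s ≠ 0 := h.ne i
  have key : ∀ U : Set ℂ, IsOpen U → U.Nonempty → ∃ y ∈ U, xicr s (y - V i) ≠ 0 := by
    rintro U hU ⟨p, hp⟩
    by_cases hz : xicr s (p - V i) = 0
    · obtain ⟨y, hy, hy2⟩ := off_line (hU.mem_nhds hp) 1 (normal_pos hsn) hz (by norm_num)
      exact ⟨y, hy, fun h => by rw [h] at hy2; simp at hy2⟩
    · exact ⟨p, hp, hz⟩
  rcases hcst 1 with hL | hL <;> rcases hcst (-1) with hR | hR
  · exfalso
    apply hqT.2
    rw [mem_interior_iff_mem_nhds]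
    refine Filter.mem_of_superset hBn ?_
    intro y hy
    by_contra hyK
    obtain ⟨y', ⟨hy1, hy2⟩, hy'⟩ := key (Metric.ball q ε ∩ Kᶜ)
      (Metric.isOpen_ball.inter hclosed.isOpen_compl) ⟨y, hy, hyK⟩
    rcases lt_or_gt_of_ne hy' with h3 | h3
    · exact hy2 (hR y' ⟨hy1, by linarith⟩)
    · exact hy2 (hL y' ⟨hy1, by linarith⟩)
  · left
    filter_upwards [hBn] with y hy
    exact ⟨fun h => hL y ⟨hy, h⟩, fun h => hR y ⟨hy, by linarith⟩⟩
  · right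
    filter_upwards [hBn] with y hy
    exact ⟨fun h => hR y ⟨hy, h⟩, fun h => hL y ⟨hy, by linarith⟩⟩
  · exfalso
    have hqK : q ∈ closure (interior K) := by
      rw [← h.regular]; exact hclosed.frontier_subset hqT
    obtain ⟨p, hp⟩ := mem_closure_iff.1 hqK _ Metric.isOpen_ball (Metric.mem_ball_self hε)
    obtain ⟨y', ⟨hy1, hy2⟩, hy'⟩ := key (Metric.ball q ε ∩ interior K)
      (Metric.isOpen_ball.inter isOpen_interior) ⟨p, hp⟩
    have hy2 := interior_subset hy2
    rcases lt_or_gt_of_ne hy' with h3 | h3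
    · exact hR y' ⟨hy1, by linarith⟩ hy2
    · exact hL y' ⟨hy1, by linarith⟩ hy2

lemma side_unique (h : XiPoly K n V) (i : ℕ) {t : ℝ} 
    (h1 : Side K V i 1 (V i + t * (V (i+1) - V i)))
    (h2 : Side K V i (-1) (V i + t * (V (i+1) - V i))) : False := by
  obtain ⟨y, hy, hy2⟩ := off_line (h1.and h2) 1 (normal_pos (h.ne i)) (v := V i)
    (by rw [add_sub_cancel_left, xicr_self]) (by norm_num)
  exact hy.2.2 (by linarith) (hy.1.1 hy2)

lemma side_edge (h : XiPoly K n V) (i : ℕ) : ∃ σ : ℝ, (σ = 1 ∨ σ = -1) ∧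
    ∀ t : ℝ, 0 < t → t < 1 → Side K V i σ (V i + t * (V (i+1) - V i)) := by
  have hop : ∀ σ, IsOpen {t : ℝ | Side K V i σ (V i + t * (V (i+1) - V i))} := by
    intro σ
    have : IsOpen {q : ℂ | Side K V i σ q} := by
      rw [isOpen_iff_mem_nhds]
      intro q hq
      exact eventually_eventually_nhds.2 hq
    exact this.preimage (by fun_prop : Continuous fun t : ℝ => V i + t * (V (i+1) - V i))
  by_cases hA : ∀ t : ℝ, 0 < t → t < 1 → Side K V i 1 (V i + t * (V (i+1) - V i))
  · exact ⟨1, Or.inl rfl, hA⟩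
  · refine ⟨-1, Or.inr rfl, ?_⟩
    intro t h0 h1
    push Not at hA
    obtain ⟨t', h0', h1', hn⟩ := hA
    by_contra hc
    have hpre : IsPreconnected (Set.Ioo (0:ℝ) 1) := isPreconnected_Ioo
    obtain ⟨r, hr, hr1, hr2⟩ := hpre _ _ (hop 1) (hop (-1))
      (fun r hr => h.side_exists i hr.1 hr.2)
      ⟨t, ⟨h0, h1⟩, (h.side_exists i h0 h1).resolve_right hc⟩
      ⟨t', ⟨h0', h1'⟩, (h.side_exists i h0' h1').resolve_left hn⟩
    exact h.side_unique i hr1 hr2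

lemma bisect {s t : ℂ} (hs : s ≠ 0) (hw : t / s ∈ Complex.slitPlane) :
    ∃ ν, 0 < xicr s ν ∧ 0 < xicr t ν := by
  set w := t / s with hwd
  have hts : t = w * s := by rw [hwd]; field_simp
  have hpos := Complex.normSq_pos.2 hs
  rw [Complex.normSq_apply] at hpos
  have e1 : ∀ μ : ℂ, xicr s (s * μ) = (s.re * s.re + s.im * s.im) * μ.im := by
    intro μ; unfold xicr; simp; ring
  have e2 : ∀ μ : ℂ, xicr t (s * μ) = (s.re * s.re + s.im * s.im) * (w.re * μ.im - w.im * μ.re) := by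
    intro μ; rw [hts]; unfold xicr; simp; ring
  rcases Complex.mem_slitPlane_iff.1 hw with h | h
  · refine ⟨s * Complex.I, ?_, ?_⟩
    · rw [e1]; simpa using hpos
    · rw [e2]; simpa using mul_pos hpos h
  · refine ⟨s * (⟨-(1 + |w.re|) / w.im, 1⟩ : ℂ), ?_, ?_⟩
    · rw [e1]; simpa using hpos
    · rw [e2]
      apply mul_pos hpos
      have : w.im * (-(1 + |w.re|) / w.im) = -(1 + |w.re|) := by field_simp
      simp only [this]
      linarith [neg_abs_le w.re]

lemma side_step (h : XiPoly K n V) (i : ℕ) {σ σ' : ℝ} (hσ : σ = 1 ∨ σ = -1)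
    (hσ' : σ' = 1 ∨ σ' = -1)
    (h1 : ∀ t : ℝ, 0 < t → t < 1 → Side K V i σ (V i + t * (V (i+1) - V i)))
    (h2 : ∀ t : ℝ, 0 < t → t < 1 → Side K V (i+1) σ' (V (i+1) + t * (V (i+2) - V (i+1)))) :
    σ = σ' := by
  obtain ⟨ν, hν1, hν2⟩ := bisect (h.ne i) (xi_slit_of_nonopp (h.ne i) (h.ne (i+1)) (h.opp i))
  obtain ⟨ε, hε, hB⟩ := Metric.eventually_nhds_iff_ball.1 (h.near_vert i)
  rw [show i + 1 + 1 = i + 2 from rfl] at hν2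
  set v := V (i+1) with hv
  set s := v - V i with hs
  set r := V (i+2) - v with hr
  have hBn := Metric.ball_mem_nhds v hε
  obtain ⟨τ, hτ, hτc⟩ : ∃ τ : ℝ, (τ = 1 ∨ τ = -1) ∧ 0 ≤ τ * xicr s r := by
    rcases le_total 0 (xicr s r) with h | h
    · exact ⟨1, Or.inl rfl, by linarith⟩
    · exact ⟨-1, Or.inr rfl, by linarith⟩
  have hττ : τ * τ = 1 := by rcases hτ with h | h <;> rw [h] <;> norm_num
  set W := {y | y ∈ {y | y ∈ Metric.ball v ε ∧ 0 < τ * xicr s (y - v)} ∧ 0 < τ * xicr r (y - v)} with hW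
  have hWc : (∀ y ∈ W, y ∈ K) ∨ (∀ y ∈ W, y ∉ K) := by
    apply const_of_convex (half_convex _ (half_convex _ (convex_ball _ _) _ _ _) _ _ _)
    rintro y ⟨⟨hy, hy1⟩, hy2⟩ hyT
    rcases hB y hy hyT with h3 | h3
    · rw [h3] at hy1; simp at hy1
    · rw [h3] at hy2; simp at hy2
  -- general probing
  have probe : ∀ q ∈ Metric.ball v ε, 0 ≤ τ * xicr s (q - v) → 0 ≤ τ * xicr r (q - v) →
      ∀ p : ℂ → Prop, (∀ᶠ y in nhds q, p y) → ∃ y ∈ W, p y := by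
    intro q hq hq1 hq2 p hp
    have ht : Filter.Tendsto (fun η : ℝ => q + (η * τ : ℝ) * ν) (nhds 0) (nhds q) := by
      have : Continuous (fun η : ℝ => q + (η * τ : ℝ) * ν) := by fun_prop
      simpa using this.tendsto 0
    have hb : ∀ᶠ y in nhds q, p y ∧ y ∈ Metric.ball v ε := hp.and (Metric.isOpen_ball.mem_nhds hq)
    have h3 : ∀ᶠ η in nhdsWithin (0:ℝ) (Set.Ioi 0), p (q + (η * τ : ℝ) * ν) ∧ q + (η * τ : ℝ) * ν ∈ Metric.ball v ε :=
      (ht.mono_left nhdsWithin_le_nhds).eventually hb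
    obtain ⟨η, hη, hη0⟩ := (h3.and self_mem_nhdsWithin).exists
    refine ⟨_, ⟨⟨hη.2, ?_⟩, ?_⟩, hη.1⟩
    · rw [show q + (η * τ : ℝ) * ν - v = (q - v) + (η * τ : ℝ) * ν by ring, xicr_lin]
      have : 0 < η * xicr s ν := mul_pos hη0 hν1
      have e : τ * (xicr s (q - v) + η * τ * xicr s ν) = τ * xicr s (q - v) + (τ * τ) * (η * xicr s ν) := by ring
      rw [e, hττ]; linarith
    · rw [show q + (η * τ : ℝ) * ν - v = (q - v) + (η * τ : ℝ) * ν by ring, xicr_lin]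
      have : 0 < η * xicr r ν := mul_pos hη0 hν2
      have e : τ * (xicr r (q - v) + η * τ * xicr r ν) = τ * xicr r (q - v) + (τ * τ) * (η * xicr r ν) := by ring
      rw [e, hττ]; linarith
  -- choose points on both edges near v
  have hanti : xicr r s = - xicr s r := by unfold xicr; ring
  have hss : xicr s s = 0 := by unfold xicr; ring
  have hrr : xicr r r = 0 := by unfold xicr; ring
  have near : ∀ w : ℂ, ∃ η : ℝ, 0 < η ∧ η < 1 ∧ v + η * w ∈ Metric.ball v ε := by
    intro w
    have ht : Filter.Tendsto (fun η : ℝ => v + η * w) (nhds 0) (nhds v) := by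
      have : Continuous (fun η : ℝ => v + η * w) := by fun_prop
      simpa using this.tendsto 0
    have h3 : ∀ᶠ η : ℝ in nhdsWithin (0:ℝ) (Set.Ioi 0), v + η * w ∈ Metric.ball v ε :=
      (ht.mono_left nhdsWithin_le_nhds).eventually hBn
    have h4 : ∀ᶠ η : ℝ in nhdsWithin (0:ℝ) (Set.Ioi 0), η < 1 :=
      nhdsWithin_le_nhds (Iio_mem_nhds (by norm_num : (0:ℝ) < 1))
    obtain ⟨η, ⟨hη, hη1⟩, hη0⟩ := ((h3.and h4).and (self_mem_nhdsWithin : Set.Ioi (0:ℝ) ∈ _)).exists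
    exact ⟨η, hη0, hη1, hη⟩
  obtain ⟨η, hη0, hη1, hηB⟩ := near (-s)
  obtain ⟨η', hη0', hη1', hηB'⟩ := near r
  have hA := h1 (1 - η) (by linarith) (by linarith)
  have eA : V i + ((1 - η : ℝ) : ℂ) * s = v + η * (-s) := by rw [hs]; push_cast; ring
  rw [eA] at hA
  have hC := h2 η' hη0' hη1'
  obtain ⟨y, hyW, hy⟩ := probe _ hηB (by
      rw [add_sub_cancel_left, show (η : ℂ) * -s = ((-η : ℝ) : ℂ) * s by push_cast; ring, xicr_self]
      simp) (by
      rw [add_sub_cancel_left, show (η : ℂ) * -s = 0 + ((-η : ℝ) : ℂ) * s by push_cast; ring, xicr_lin,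
        hanti]
      have : xicr r 0 = 0 := by simp [xicr]
      rw [this]
      have := mul_nonneg hη0.le hτc
      linarith) _ hA
  obtain ⟨y', hyW', hy'⟩ := probe _ hηB' (by
      rw [add_sub_cancel_left, show (η' : ℂ) * r = 0 + (η' : ℂ) * r by ring, xicr_lin]
      have : xicr s 0 = 0 := by simp [xicr]
      rw [this]
      have := mul_nonneg hη0'.le hτc
      linarith) (by rw [add_sub_cancel_left, xicr_self]; simp) _ hC
  have k1 : 0 < τ * xicr s (y - V i) := by
    have : y - V i = (y - v) + (1:ℝ) * s := by rw [hs]; push_cast; ring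
    rw [this, xicr_lin, hss]; simpa using hyW.1.2
  have k2 : 0 < τ * xicr r (y' - v) := hyW'.2
  rw [show i + 1 + 1 = i + 2 from rfl, ← hv, ← hr] at hy'
  rw [← hv, ← hs] at hy
  rcases hWc with hK | hK
  · have a1 := hK y hyW
    have a2 := hK y' hyW'
    have b1 : σ = τ := by
      rcases hσ with h3 | h3 <;> rcases hτ with h4 | h4
      · rw [h3, h4]
      · rw [h3] at hy; rw [h4] at k1; exact absurd a1 (hy.2 (by linarith))
      · rw [h3] at hy; rw [h4] at k1; exact absurd a1 (hy.2 (by linarith))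
      · rw [h3, h4]
    have b2 : σ' = τ := by
      rcases hσ' with h3 | h3 <;> rcases hτ with h4 | h4
      · rw [h3, h4]
      · rw [h3] at hy'; rw [h4] at k2; exact absurd a2 (hy'.2 (by linarith))
      · rw [h3] at hy'; rw [h4] at k2; exact absurd a2 (hy'.2 (by linarith))
      · rw [h3, h4]
    rw [b1, b2]
  · have a1 := hK y hyW
    have a2 := hK y' hyW'
    have b1 : σ ≠ τ := by
      rintro rfl
      exact a1 (hy.1 k1)
    have b2 : σ' ≠ τ := by
      rintro rfl
      exact a2 (hy'.1 k2)
    rcases hσ with h3 | h3 <;> rcases hσ' with h5 | h5 <;> rcases hτ with h4 | h4 <;>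
      simp_all

lemma side_all (h : XiPoly K n V) : ∃ σ : ℝ, (σ = 1 ∨ σ = -1) ∧
    ∀ i, ∀ t : ℝ, 0 < t → t < 1 → Side K V i σ (V i + t * (V (i+1) - V i)) := by
  obtain ⟨σ, hσ, h0⟩ := h.side_edge 0
  refine ⟨σ, hσ, fun i => ?_⟩
  induction i with
  | zero => exact h0
  | succ i ih =>
    obtain ⟨σ', hσ', h1⟩ := h.side_edge (i+1)
    have := h.side_step i hσ hσ' ih h1
    rwa [this]

end XiPoly

def xiwind (n : ℕ) (V : ℕ → ℂ) (y : ℂ) : ℝ :=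
  ∑ i ∈ Finset.range n, Complex.arg ((V (i+1) - y) / (V i - y))

lemma xi_im_div (a s : ℂ) (y : ℂ) : ((a + s - y) / (a - y)).im =
    xicr s (y - a) / Complex.normSq (a - y) := by
  rw [Complex.div_im]
  unfold xicr
  simp
  ring

lemma xi_im_div' (s d : ℂ) : (d / s).im = xicr s d / Complex.normSq s := by
  rw [Complex.div_im]
  unfold xicr
  ring

namespace XiPoly
variable {K : Set ℂ} {n : ℕ} {V : ℕ → ℂ}

lemma vert_mem (h : XiPoly K n V) (i : ℕ) : V i ∈ frontier K := by
  have := h.bd' i (t := 0) le_rfl (by norm_num)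
  simpa using this

lemma wind_int (h : XiPoly K n V) {y : ℂ} (hy : ∀ i, V i ≠ y) : ∃ k : ℤ, xiwind n V y = 2 * π * k := by
  have e : ((xiwind n V y : ℝ) : Real.Angle) = ((0:ℝ) : Real.Angle) := by
    unfold xiwind
    have hc : ((∑ i ∈ Finset.range n, Complex.arg ((V (i+1) - y) / (V i - y)) : ℝ) : Real.Angle) =
        ∑ i ∈ Finset.range n, ((Complex.arg ((V (i+1) - y) / (V i - y)) : ℝ) : Real.Angle) :=
      map_sum Real.Angle.coeHom _ _
    rw [hc]
    have : ∀ i ∈ Finset.range n, ((Complex.arg ((V (i+1) - y) / (V i - y)) : ℝ) : Real.Angle) =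
        (Complex.arg (V (i+1) - y) : Real.Angle) - (Complex.arg (V i - y) : Real.Angle) := by
      intro i _
      exact Complex.arg_div_coe_angle (sub_ne_zero.2 (hy _)) (sub_ne_zero.2 (hy _))
    rw [Finset.sum_congr rfl this, Finset.sum_range_sub (fun i => (Complex.arg (V i - y) : Real.Angle))]
    have := h.per 0
    rw [zero_add] at this
    rw [this]; simp
  rw [Real.Angle.angle_eq_iff_two_pi_dvd_sub] at e
  simpa using e

lemma ratio_slit {i : ℕ} {q : ℂ} (hq : q ∉ edgeSet V i) : (V (i+1) - q) / (V i - q) ∈ Complex.slitPlane := by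
  apply xi_slit_of_nonopp
  · intro h0
    exact hq ⟨0, le_rfl, by norm_num, by push_cast; linear_combination -h0⟩
  · intro h0
    exact hq ⟨1, by norm_num, le_rfl, by push_cast; linear_combination -h0⟩
  · intro a ha he
    have h1 : (1 - a) ≠ 0 := by linarith
    have h1' : (1 - a : ℂ) ≠ 0 := by exact_mod_cast h1
    refine hq ⟨1 / (1 - a), by apply div_nonneg <;> linarith, by
      rw [div_le_one (by linarith)]; linarith, ?_⟩
    push_cast
    field_simp
    linear_combination (-1) * he

lemma ratio_cont {i : ℕ} {q : ℂ} (hq : q ∉ edgeSet V i) :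
    ContinuousAt (fun y => Complex.arg ((V (i+1) - y) / (V i - y))) q := by
  have h0 : V i - q ≠ 0 := by
    intro h0
    exact hq ⟨0, le_rfl, by norm_num, by push_cast; linear_combination -h0⟩
  have := Complex.continuousAt_arg (ratio_slit hq)
  exact ContinuousAt.comp (f := fun y => (V (i+1) - y) / (V i - y)) this
    ((by fun_prop : ContinuousAt (fun y => V (i+1) - y) q).div (by fun_prop) h0)

open Classical in
def g (K : Set ℂ) (n : ℕ) (V : ℕ → ℂ) (σ : ℝ) (y : ℂ) : ℝ :=
  xiwind n V y - σ * (2 * π) * (if y ∈ K then 1 else 0)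

lemma g_int (h : XiPoly K n V) {σ : ℝ} (hσ : σ = 1 ∨ σ = -1) {y : ℂ} (hy : y ∉ frontier K) :
    ∃ k : ℤ, g K n V σ y = 2 * π * k := by
  obtain ⟨k, hk⟩ := h.wind_int (y := y) (fun i hi => hy (hi ▸ h.vert_mem i))
  unfold g
  rw [hk]
  split_ifs
  · rcases hσ with rfl | rfl
    · exact ⟨k - 1, by push_cast; ring⟩
    · exact ⟨k + 1, by push_cast; ring⟩
  · exact ⟨k, by ring⟩

lemma loc_const {T : Set ℂ} {g G : ℂ → ℝ} {q : ℂ} (hG : ContinuousAt G q)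
    (hg : ∀ᶠ y in nhds q, y ∉ T → g y = G y) (hi : ∀ y, y ∉ T → ∃ k : ℤ, g y = 2 * π * k) :
    ∃ c, ∀ᶠ y in nhds q, y ∉ T → g y = c := by
  have hb : ∀ᶠ y in nhds q, |G y - G q| < 1 := by
    have := Metric.continuousAt_iff'.1 hG 1 one_pos
    simpa [Real.dist_eq] using this
  have hU := hg.and hb
  obtain ⟨ε, hε, hB⟩ := Metric.eventually_nhds_iff_ball.1 hU
  by_cases hex : ∃ y0 ∈ Metric.ball q ε, y0 ∉ T
  · obtain ⟨y0, hy0, hy0T⟩ := hex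
    refine ⟨g y0, ?_⟩
    filter_upwards [Metric.ball_mem_nhds q hε] with y hy hyT
    obtain ⟨k, hk⟩ := hi y hyT
    obtain ⟨k0, hk0⟩ := hi y0 hy0T
    have e1 := hB y hy
    have e0 := hB y0 hy0
    have f1 := e1.1 hyT
    have f0 := e0.1 hy0T
    have a1 := abs_lt.1 e1.2
    have a0 := abs_lt.1 e0.2
    have hlt : |2 * π * ((k - k0 : ℤ) : ℝ)| < 2 := by
      push_cast
      rw [abs_lt]; constructor <;> nlinarith
    have : k - k0 = 0 := by
      by_contra hne
      have h1 : (1:ℝ) ≤ |((k - k0 : ℤ) : ℝ)| := by exact_mod_cast Int.one_le_abs hne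
      rw [abs_mul, abs_of_pos Real.two_pi_pos] at hlt
      nlinarith [Real.pi_gt_three]
    rw [hk, hk0, show k = k0 by omega]
  · refine ⟨0, ?_⟩
    filter_upwards [Metric.ball_mem_nhds q hε] with y hy hyT
    exact absurd ⟨y, hy, hyT⟩ hex

lemma g_loc_off (h : XiPoly K n V) {σ : ℝ} (hσ : σ = 1 ∨ σ = -1) {q : ℂ} (hq : q ∉ frontier K) :
    ∃ c, ∀ᶠ y in nhds q, y ∉ frontier K → g K n V σ y = c := by
  classical
  have hedge : ∀ i, i < n → q ∉ edgeSet V i := by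
    intro i hi ⟨t, h0, h1, he⟩
    exact hq (by rw [h.bd]; exact ⟨i, hi, t, h0, h1, he⟩)
  have hK : ∀ᶠ y in nhds q, (y ∈ K ↔ q ∈ K) := by
    by_cases hqK : q ∈ K
    · have : q ∈ interior K := by
        by_contra hn; exact hq ⟨subset_closure hqK, hn⟩
      filter_upwards [mem_interior_iff_mem_nhds.1 this] with y hy
      exact ⟨fun _ => hqK, fun _ => hy⟩
    · filter_upwards [h.compact.isClosed.isOpen_compl.mem_nhds hqK] with y hy
      exact ⟨fun hh => absurd hh hy, fun hh => absurd hh hqK⟩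
  apply loc_const (G := fun y => xiwind n V y - σ * (2 * π) * (if q ∈ K then 1 else 0)) _ _
    (fun y hy => h.g_int hσ hy)
  · apply ContinuousAt.sub _ continuousAt_const
    unfold xiwind
    exact tendsto_finsetSum _ fun i hi => ratio_cont (hedge i (Finset.mem_range.1 hi))
  · filter_upwards [hK] with y hy _
    unfold g
    simp only [hy]

lemma g_loc_on (h : XiPoly K n V) {σ : ℝ} (hσ : σ = 1 ∨ σ = -1)
    (hS : ∀ i, ∀ t : ℝ, 0 < t → t < 1 → Side K V i σ (V i + t * (V (i+1) - V i)))
    {i : ℕ} (hi : i < n) {t : ℝ} (h0 : 0 < t) (h1 : t < 1) :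
    ∃ c, ∀ᶠ y in nhds (V i + t * (V (i+1) - V i)), y ∉ frontier K → g K n V σ y = c := by
  classical
  have hSi := hS i t h0 h1
  unfold Side at hSi
  set q := V i + t * (V (i+1) - V i) with hq
  set s := V (i+1) - V i with hs
  have hsn : s ≠ 0 := h.ne i
  have hV1 : V (i+1) = V i + s := by rw [hs]; ring
  have hedge : ∀ j ∈ (Finset.range n).erase i, q ∉ edgeSet V j := by
    intro j hj ⟨t', h0', h1', he⟩
    rw [Finset.mem_erase, Finset.mem_range] at hj
    rcases h.simp' h0.le h1 h0' h1' he with h2 | h2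
    · exact hj.1 (Nat.ModEq.eq_of_lt_of_lt h2.1 hi hj.2).symm
    · exact h0.ne' h2.1
  have hVq : V i - q ≠ 0 := by
    rw [hq, sub_add_cancel_left, neg_ne_zero]
    exact mul_ne_zero (by exact_mod_cast h0.ne') hsn
  apply loc_const (G := fun y => (Complex.arg (-((V (i+1) - y) / (V i - y))) +
    ∑ j ∈ (Finset.range n).erase i, Complex.arg ((V (j+1) - y) / (V j - y))) - σ * π) _ _
    (fun y hy => h.g_int hσ hy)
  · apply ContinuousAt.sub _ continuousAt_const
    apply ContinuousAt.add
    · have hsl : -((V (i+1) - q) / (V i - q)) ∈ Complex.slitPlane := by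
        have : -((V (i+1) - q) / (V i - q)) = (((1 - t) / t : ℝ) : ℂ) := by
          have ht : (t : ℂ) ≠ 0 := by exact_mod_cast h0.ne'
          rw [← neg_div, div_eq_iff hVq, hV1, hq]
          push_cast
          field_simp
          ring
        rw [this, Complex.ofReal_mem_slitPlane]
        apply div_pos <;> linarith
      exact ContinuousAt.comp (f := fun y => -((V (i+1) - y) / (V i - y))) (Complex.continuousAt_arg hsl)
        ((by fun_prop : ContinuousAt (fun y => V (i+1) - y) q).div (by fun_prop) hVq).neg
    · exact tendsto_finsetSum _ fun j hj => ratio_cont (hedge j hj)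
  · have ht1 : ∀ᶠ y in nhds q, ((y - V i) / s).re ∈ Set.Ioo (0:ℝ) 1 := by
      have hc : ContinuousAt (fun y => ((y - V i) / s).re) q := by
        apply Complex.continuous_re.continuousAt.comp
        exact ContinuousAt.div (by fun_prop) (by fun_prop) hsn
      apply hc
      have : ((q - V i) / s).re = t := by
        rw [hq, add_sub_cancel_left, mul_div_cancel_right₀ _ hsn, Complex.ofReal_re]
      show Set.Ioo (0:ℝ) 1 ∈ nhds (((q - V i) / s).re)
      rw [this]
      exact Ioo_mem_nhds h0 h1
    have hne : ∀ᶠ y in nhds q, V i - y ≠ 0 := by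
      have hc : ContinuousAt (fun y => V i - y) q := by fun_prop
      exact hc.eventually_ne hVq
    filter_upwards [hSi, ht1, hne] with y hy hyt hyn hyT
    have hns : 0 < Complex.normSq (V i - y) := Complex.normSq_pos.2 hyn
    have him := xi_im_div (V i) s y
    rw [← hV1] at him
    have hsum : xiwind n V y = Complex.arg ((V (i+1) - y) / (V i - y)) +
      ∑ j ∈ (Finset.range n).erase i, Complex.arg ((V (j+1) - y) / (V j - y)) := by
      unfold xiwind
      rw [Finset.add_sum_erase _ (fun j => Complex.arg ((V (j+1) - y) / (V j - y))) (Finset.mem_range.2 hi)]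
    unfold g
    rw [hsum]
    rcases lt_trichotomy (xicr s (y - V i)) 0 with hc | hc | hc
    · have : ((V (i+1) - y) / (V i - y)).im < 0 := by rw [him]; exact div_neg_of_neg_of_pos hc hns
      rw [Complex.arg_neg_eq_arg_add_pi_of_im_neg this]
      rcases hσ with rfl | rfl
      · rw [if_neg (hy.2 (by linarith))]; ring
      · rw [if_pos (hy.1 (by linarith))]; ring
    · exfalso
      apply hyT
      have h3 : ((y - V i) / s).im = 0 := by rw [xi_im_div', hc]; simp
      have h4 : (y - V i) / s = ((((y - V i) / s).re : ℝ) : ℂ) := by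
        apply Complex.ext
        · simp
        · rw [h3]; simp
      rw [div_eq_iff hsn] at h4
      rw [show y = V i + ((((y - V i) / s).re : ℝ) : ℂ) * s by rw [← h4]; ring]
      exact h.bd' i hyt.1.le hyt.2.le
    · have : 0 < ((V (i+1) - y) / (V i - y)).im := by rw [him]; exact div_pos hc hns
      rw [Complex.arg_neg_eq_arg_sub_pi_of_im_pos this]
      rcases hσ with rfl | rfl
      · rw [if_pos (hy.1 (by linarith))]; ring
      · rw [if_neg (hy.2 (by linarith))]; ring

lemma g_loc (h : XiPoly K n V) {σ : ℝ} (hσ : σ = 1 ∨ σ = -1)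
    (hS : ∀ i, ∀ t : ℝ, 0 < t → t < 1 → Side K V i σ (V i + t * (V (i+1) - V i)))
    {q : ℂ} (hq : ∀ i, q ≠ V i) :
    ∃ c, ∀ᶠ y in nhds q, y ∉ frontier K → g K n V σ y = c := by
  by_cases hqT : q ∈ frontier K
  · rw [h.bd] at hqT
    obtain ⟨i, hi, t, h0, h1, rfl⟩ := hqT
    refine h.g_loc_on hσ hS hi (h0.lt_of_ne ?_) (h1.lt_of_ne ?_)
    · rintro rfl; exact hq i (by simp)
    · rintro rfl; exact hq (i+1) (by simp)
  · exact h.g_loc_off hσ hqT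

lemma far (h : XiPoly K n V) : ∃ y0, y0 ∉ K ∧ xiwind n V y0 = 0 := by
  obtain ⟨R, hR⟩ := h.compact.isBounded.exists_norm_le
  have hVK : ∀ i, V i ∈ K := fun i => h.compact.isClosed.frontier_subset (h.vert_mem i)
  have hR0 : 0 ≤ R := (norm_nonneg _).trans (hR _ (hVK 0))
  have hre : ∀ y ∈ K, 0 < (y - ((-(R+1) : ℝ) : ℂ)).re := by
    intro y hy
    have := (abs_le.1 ((Complex.abs_re_le_norm y).trans (hR y hy))).1
    simp; linarith
  refine ⟨((-(R+1) : ℝ) : ℂ), ?_, ?_⟩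
  · intro hm
    have := hre _ hm
    simp at this
  · unfold xiwind
    have : ∀ i ∈ Finset.range n, Complex.arg ((V (i+1) - ((-(R+1) : ℝ) : ℂ)) / (V i - ((-(R+1) : ℝ) : ℂ)))
        = Complex.arg (V (i+1) - ((-(R+1) : ℝ) : ℂ)) - Complex.arg (V i - ((-(R+1) : ℝ) : ℂ)) := by
      intro i _
      exact xi_arg_div_re (hre _ (hVK _)) (hre _ (hVK _))
    rw [Finset.sum_congr rfl this, Finset.sum_range_sub (fun i => Complex.arg (V i - ((-(R+1) : ℝ) : ℂ)))]
    have := h.per 0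
    rw [zero_add] at this
    rw [this, sub_self]

lemma wind_zero (h : XiPoly K n V) {x : ℂ} (hx : x ∉ K) : xiwind n V x = 0 := by
  classical
  obtain ⟨σ, hσ, hS⟩ := h.side_all
  obtain ⟨y0, hy0, hf0⟩ := h.far
  have hgo : ∀ y, y ∉ K → g K n V σ y = xiwind n V y := by
    intro y hy; unfold g; rw [if_neg hy]; ring
  have hTK : ∀ y, y ∉ K → y ∉ frontier K := fun y hy hT => hy (h.compact.isClosed.frontier_subset hT)
  have hconn : IsPreconnected (Set.range V)ᶜ := by
    refine (Set.Countable.isConnected_compl_of_one_lt_rank ?_ (Set.countable_range V)).isPreconnected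
    rw [Complex.rank_real_complex]; norm_num
  have hmem : ∀ y, y ∉ K → y ∈ (Set.range V)ᶜ := by
    rintro y hy ⟨i, rfl⟩
    exact hTK _ hy (h.vert_mem i)
  have hloc : ∀ q ∈ (Set.range V)ᶜ, ∃ c, ∀ᶠ y in nhds q, y ∉ frontier K → g K n V σ y = c := by
    intro q hq
    exact h.g_loc hσ hS (fun i hi => hq ⟨i, hi.symm⟩)
  rw [← hgo x hx]
  by_contra hne
  set c0 := g K n V σ x with hc0
  have key : ∀ y, y ∉ K → ∀ᶠ y' in nhds y, y' ∉ frontier K → g K n V σ y' = g K n V σ y := by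
    intro y hy
    obtain ⟨c, hc⟩ := hloc y (hmem y hy)
    rwa [hc.self_of_nhds (hTK y hy)]
  obtain ⟨q, -, hqA, hqB⟩ := hconn {q | ∀ᶠ y in nhds q, y ∉ frontier K → g K n V σ y = c0}
    {q | ∀ᶠ y in nhds q, y ∉ frontier K → g K n V σ y ≠ c0}
    (isOpen_iff_mem_nhds.2 fun q hq => eventually_eventually_nhds.2 hq)
    (isOpen_iff_mem_nhds.2 fun q hq => eventually_eventually_nhds.2 hq)
    (by
      intro q hq
      obtain ⟨c, hc⟩ := hloc q hq
      by_cases hcc : c = c0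
      · left; rw [← hcc]; exact hc
      · right
        filter_upwards [hc] with y hy hyT
        rw [hy hyT]; exact hcc)
    ⟨x, hmem x hx, key x hx⟩
    ⟨y0, hmem y0 hy0, by
      filter_upwards [key y0 hy0] with y hy hyT
      rw [hy hyT, hgo y0 hy0, hf0]; exact Ne.symm hne⟩
  have hT : ∀ᶠ y in nhds q, y ∈ frontier K := by
    filter_upwards [hqA, hqB] with y h1 h2
    by_contra hyT
    exact h2 hyT (h1 hyT)
  have : q ∈ interior (frontier K) := mem_interior_iff_mem_nhds.2 hT
  rw [interior_frontier h.compact.isClosed] at this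
  exact this

end XiPoly

def xith (z : ℕ → ℂ) : ℕ → ℝ
  | 0 => Complex.arg (z 0)
  | i + 1 => xith z i + Complex.arg (z (i+1) / z i)

lemma xith_sum (z : ℕ → ℂ) (m : ℕ) :
    xith z m = xith z 0 + ∑ i ∈ Finset.range m, Complex.arg (z (i+1) / z i) := by
  induction m with
  | zero => simp
  | succ m ih => rw [Finset.sum_range_succ, ← add_assoc, ← ih, xith]

lemma xith_polar (z : ℕ → ℂ) (hz : ∀ i, z i ≠ 0) (i : ℕ) :
    z i = ‖z i‖ * Complex.exp (xith z i * Complex.I) := by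
  induction i with
  | zero => exact (Complex.norm_mul_exp_arg_mul_I (z 0)).symm
  | succ i ih => exact xi_polar_mul ih (hz i)

namespace XiPoly
variable {K : Set ℂ} {n : ℕ} {V : ℕ → ℂ}

lemma edge_ne (h : XiPoly K n V) {x : ℂ} (hx : x ∉ K) (i : ℕ) {t : ℝ} (h0 : 0 ≤ t) (h1 : t ≤ 1) :
    (V i - x) + t * ((V (i+1) - x) - (V i - x)) ≠ 0 := by
  intro he
  apply hx
  apply h.compact.isClosed.frontier_subset
  have : x = V i + t * (V (i+1) - V i) := by linear_combination -he
  rw [this]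
  exact h.bd' i h0 h1

lemma z_ne (h : XiPoly K n V) {x : ℂ} (hx : x ∉ K) (i : ℕ) : V i - x ≠ 0 := by
  have := h.edge_ne hx i (t := 0) le_rfl (by norm_num)
  simpa using this

lemma th_per (h : XiPoly K n V) {x : ℂ} (hx : x ∉ K) (i : ℕ) :
    xith (fun j => V j - x) (i + n) = xith (fun j => V j - x) i := by
  induction i with
  | zero =>
    rw [zero_add, xith_sum]
    have := h.wind_zero hx
    unfold xiwind at this
    rw [this, add_zero]
  | succ i ih =>
    rw [show i + 1 + n = (i + n) + 1 by ring, xith, ih, xith]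
    have e := h.per (i+1)
    rw [show i + 1 + n = (i + n) + 1 by ring] at e
    simp only [e, h.per i]

lemma th_per_mul (h : XiPoly K n V) {x : ℂ} (hx : x ∉ K) (i m : ℕ) :
    xith (fun j => V j - x) (i + n * m) = xith (fun j => V j - x) i := by
  induction m with
  | zero => simp
  | succ m ih => rw [show i + n * (m+1) = (i + n * m) + n by ring, h.th_per hx, ih]

lemma region_small (h : XiPoly K n V) {x : ℂ} (hx : x ∉ K) {β lo hi : ℝ} (hβ0 : 0 ≤ β) (hβ1 : β < π)
    (hlo : ∀ i, lo ≤ xith (fun j => V j - x) i) (hhi : ∀ i, xith (fun j => V j - x) i ≤ hi)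
    (hs : hi - lo < π + β) :
    ∃ u v : ℂ, u ≠ 0 ∧ v ≠ 0 ∧ Complex.arg (v / u) = π - β ∧
      ∀ a b : ℝ, 0 ≤ a → 0 ≤ b → x + (a * u + b * v) ∉ K := by
  set A := (hi + lo + π + β) / 2 with hA
  set u := Complex.exp (A * Complex.I) with hu
  set w := Complex.exp (((π - β : ℝ) : ℂ) * Complex.I) with hw
  have hargw : Complex.arg w = π - β := by
    rw [hw, Complex.arg_exp_mul_I]
    rw [toIocMod_eq_self]
    constructor <;> linarith
  have hu0 : u ≠ 0 := Complex.exp_ne_zero _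
  have hw0 : w ≠ 0 := Complex.exp_ne_zero _
  refine ⟨u, u * w, hu0, mul_ne_zero hu0 hw0, ?_, ?_⟩
  · rw [mul_div_cancel_left₀ _ hu0, hargw]
  · set W : Set ℂ := {y | ∃ a b : ℝ, 0 ≤ a ∧ 0 ≤ b ∧ y = x + (a * u + b * (u * w))} with hW
    have hconv : Convex ℝ W := by
      rintro _ ⟨a, b, ha, hb, rfl⟩ _ ⟨a', b', ha', hb', rfl⟩ r r' hr hr' hrr
      refine ⟨r * a + r' * a', r * b + r' * b', by positivity, by positivity, ?_⟩
      simp only [Complex.real_smul]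
      have : (r : ℂ) + r' = 1 := by exact_mod_cast hrr
      push_cast
      linear_combination x * this
    have hT : ∀ y ∈ W, y ∉ frontier K := by
      rintro y ⟨a, b, ha, hb, hy⟩ hyT
      rw [h.bd] at hyT
      obtain ⟨i, hi', t, h0, h1, hyt⟩ := hyT
      have hz := h.z_ne hx
      have hpol := xith_polar (fun j => V j - x) hz i
      obtain ⟨γ, hγ, hγ1, hγ2⟩ := xi_edge_polar hpol (fun t h0 h1 => h.edge_ne hx i h0 h1) h0 h1
      have e1 : xith (fun j => V j - x) (i+1) = xith (fun j => V j - x) i +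
        Complex.arg ((V (i+1) - x) / (V i - x)) := rfl
      rw [← e1] at hγ1 hγ2
      have hne := h.edge_ne hx i h0 h1
      set p := (V i - x) + t * ((V (i+1) - x) - (V i - x)) with hp
      have hpe : p = u * (a + b * w) := by
        linear_combination hp - hyt + hy
      have hne' : (a + b * w : ℂ) ≠ 0 := by
        intro h0; rw [hpe, h0, mul_zero] at hne; exact hne rfl
      obtain ⟨c1, c2⟩ := xi_cone (by rw [hargw]; linarith) hw0 ha hb hne'
      rw [hargw] at c2
      have c2 := c2.resolve_left (by linarith)
      have hpp : p = ‖p‖ * Complex.exp (((A + Complex.arg (a + b * w) : ℝ) : ℂ) * Complex.I) := by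
        have hn : ‖p‖ = ‖(a + b * w : ℂ)‖ := by
          rw [hpe, norm_mul, hu, Complex.norm_exp_ofReal_mul_I, one_mul]
        have h2 := Complex.norm_mul_exp_arg_mul_I (a + b * w : ℂ)
        rw [hn]
        push_cast
        rw [add_mul, Complex.exp_add, ← hu]
        rw [hpe]
        linear_combination (-u) * h2
      have k1 : lo ≤ γ := (le_min (hlo i) (hlo (i+1))).trans hγ1
      have k2 : γ ≤ hi := hγ2.trans (max_le (hhi i) (hhi (i+1)))
      have k3 : γ ≤ (hi + lo + π + β) / 2 := by linarith
      refine xi_not_pos hpp hγ hne ?_ ?_ 1 one_pos (by simp)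
      · rw [hA]; linarith
      · rw [hA]; linarith
    rcases const_of_convex hconv hT with hc | hc
    · exact absurd (hc x ⟨0, 0, le_rfl, le_rfl, by simp⟩) hx
    · intro a b ha hb
      exact hc _ ⟨a, b, ha, hb, rfl⟩

lemma nmod (a b : ℕ) (h1 : a < b) (h2 : b < a + n) (h : a ≡ b [MOD n]) : False := by
  have := (Nat.modEq_iff_dvd' h1.le).1 h
  have := Nat.le_of_dvd (by omega) this
  omega

lemma edges_disj (h : XiPoly K n V) {i j : ℕ} (h1 : i + 1 < j) (h2 : j + 1 < i + n) {t t' : ℝ}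
    (h0 : 0 ≤ t) (ht1 : t ≤ 1) (h0' : 0 ≤ t') (ht1' : t' ≤ 1) :
    V i + t * (V (i+1) - V i) ≠ V j + t' * (V (j+1) - V j) := by
  intro he
  rcases ht1.lt_or_eq with ht | ht
  · rcases h.simp' h0 ht h0' ht1' he with h3 | h3
    · exact nmod i j (by omega) (by omega) h3.1
    · exact nmod i (j+1) (by omega) (by omega) h3.2
  · have he' : V (i+1) + (0:ℝ) * (V (i+1+1) - V (i+1)) = V j + t' * (V (j+1) - V j) := by
      rw [← he, ht]; push_cast; ring
    rcases h.simp' le_rfl (by norm_num) h0' ht1' he' with h3 | h3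
    · exact nmod (i+1) j (by omega) (by omega) h3.1
    · exact nmod (i+1) (j+1) (by omega) (by omega) h3.2

lemma big_rot (h : XiPoly K n V) {x : ℂ} (hx : x ∉ K) {β : ℝ} (hβ0 : 0 ≤ β) (hβ1 : β < π)
    (M b : ℕ) (hb : b + 1 < n)
    (_hmax : ∀ j, xith (fun j => V j - x) j ≤ xith (fun j => V j - x) M)
    (hlt : ∀ j, 0 < j → j ≤ b → xith (fun j => V j - x) (M + j) < xith (fun j => V j - x) M)
    (hgt : ∀ j, j ≤ b → xith (fun j => V j - x) M - (π + β) < xith (fun j => V j - x) (M + j))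
    (hend : xith (fun j => V j - x) (M + b + 1) ≤ xith (fun j => V j - x) M - (π + β)) :
    ∑ j ∈ Finset.range b, Complex.arg ((V (M+j+2) - V (M+j+1)) / (V (M+j+1) - V (M+j))) < - β := by
  have hz := h.z_ne hx
  set z := fun j => V j - x with hzd
  set θ := xith z with hθd
  have hpol := xith_polar z hz
  have hzz : ∀ j, z (j+1) - z j = V (j+1) - V j := by intro j; simp only [hzd]; ring
  have hedge : ∀ i, ∀ t : ℝ, 0 ≤ t → t ≤ 1 → z i + t * (z (i+1) - z i) ≠ 0 :=
    fun i t h0 h1 => h.edge_ne hx i h0 h1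
  -- cut point
  obtain ⟨t, ht0, ht1, hcut⟩ : ∃ t : ℝ, 0 < t ∧ t ≤ 1 ∧
      θ (M+b) + Complex.arg ((z (M+b) + t * (z (M+b+1) - z (M+b))) / z (M+b)) = θ M - (π + β) := by
    have hc : ∀ t : ℝ, (z (M+b) + t * (z (M+b+1) - z (M+b))) / z (M+b) =
        1 + t * ((z (M+b+1) - z (M+b)) / z (M+b)) := by
      intro t; have hh : z (M+b) ≠ 0 := hz (M+b); field_simp
    have hcs : ∀ t : ℝ, 0 ≤ t → t ≤ 1 → 1 + t * ((z (M+b+1) - z (M+b)) / z (M+b)) ≠ 0 := by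
      intro t h0 h1
      rw [← hc]
      exact div_ne_zero (hedge _ t h0 h1) (hz _)
    have hcont : ContinuousOn (fun t : ℝ => Complex.arg (1 + t * ((z (M+b+1) - z (M+b)) / z (M+b)))) (Set.Icc 0 1) := by
      intro t ht
      apply ContinuousAt.continuousWithinAt
      exact ContinuousAt.comp (f := fun t : ℝ => 1 + (t:ℂ) * ((z (M+b+1) - z (M+b)) / z (M+b)))
        (Complex.continuousAt_arg (xi_edge_arg hcs ht.1 ht.2)) (by fun_prop)
    have e1 : θ (M+b+1) = θ (M+b) + Complex.arg (z (M+b+1) / z (M+b)) := rfl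
    have hg := hgt b le_rfl
    have hmem : θ M - (π + β) - θ (M+b) ∈ (fun t : ℝ => Complex.arg (1 + t * ((z (M+b+1) - z (M+b)) / z (M+b)))) '' Set.Icc 0 1 := by
      apply intermediate_value_Icc' zero_le_one hcont
      constructor
      · simp only [← hc]
        simp only [Complex.ofReal_one, one_mul, add_sub_cancel]
        linarith
      · simp; linarith
    obtain ⟨t, ht, he⟩ := hmem
    refine ⟨t, ht.1.lt_of_ne ?_, ht.2, ?_⟩
    · rintro rfl
      simp at he
      linarith
    · rw [hc]; simp only at he; linarith
  set c := z (M+b) + t * (z (M+b+1) - z (M+b)) with hcd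
  set z' : ℕ → ℂ := fun j => if j ≤ b then z (M+j) else c with hz'
  set θ' : ℕ → ℝ := fun j => if j ≤ b then θ (M+j) else θ M - (π + β) with hθ'
  have zcA : ∀ j, j ≤ b → z' j = z (M+j) := fun j hj => by simp only [hz']; rw [if_pos hj]
  have zcB : z' (b+1) = c := by simp only [hz']; rw [if_neg (by omega)]
  have tcA : ∀ j, j ≤ b → θ' j = θ (M+j) := fun j hj => by simp only [hθ']; rw [if_pos hj]
  have tcB : θ' (b+1) = θ M - (π + β) := by simp only [hθ']; rw [if_neg (by omega)]
  have hsh : ∀ j, ∃ r : ℝ, j < b + 1 → 0 < r ∧ r ≤ 1 ∧ z' (j+1) - z' j = r * (V (M+j+1) - V (M+j)) := by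
    intro j
    rcases lt_trichotomy j b with hj | hj | hj
    · refine ⟨1, fun _ => ⟨one_pos, le_rfl, ?_⟩⟩
      rw [zcA j hj.le, zcA (j+1) (by omega), Complex.ofReal_one, one_mul, ← hzz]
      rfl
    · refine ⟨t, fun _ => ⟨ht0, ht1, ?_⟩⟩
      rw [hj, zcA b le_rfl, zcB, hcd, hzz]; ring
    · exact ⟨0, fun h => by omega⟩
  choose r hr using hsh
  have hpt : ∀ j, j < b + 1 → ∀ τ : ℝ, 0 ≤ τ → τ ≤ 1 → 0 ≤ τ * r j ∧ τ * r j ≤ 1 ∧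
      z' j + τ * (z' (j+1) - z' j) = (V (M+j) + ((τ * r j : ℝ) : ℂ) * (V (M+j+1) - V (M+j))) - x := by
    intro j hj τ h0 h1
    obtain ⟨r0, r1, re⟩ := hr j hj
    refine ⟨by positivity, by nlinarith, ?_⟩
    rw [re, zcA j (by omega)]
    simp only [hzd]
    push_cast; ring
  have hmain := xi_arc z' θ' b β hβ0 hβ1 (by
      intro j hj
      rcases hj.lt_or_eq with hj | hj
      · rw [zcA j (by omega), tcA j (by omega)]; exact hpol _
      · rw [hj, zcB, tcB, ← hcut]
        exact xi_polar_mul (hpol _) (hz _)) (by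
      intro j hj τ h0 h1
      obtain ⟨k0, k1, k2⟩ := hpt j hj τ h0 h1
      rw [k2]
      have := h.edge_ne hx (M+j) k0 k1
      intro h3; apply this; rw [← h3]; ring) (by
      intro j hj
      rcases (Nat.lt_succ_iff.1 hj).lt_or_eq with hj | hj
      · rw [zcA j (by omega), tcA j (by omega), zcA (j+1) (by omega), tcA (j+1) (by omega)]
        rfl
      · rw [hj, zcB, tcB, zcA b le_rfl, tcA b le_rfl, hcut]) (by
      intro j hj hj'
      rw [tcA 0 (by omega)]
      rcases hj'.lt_or_eq with hj' | hj'
      · rw [tcA j (by omega)]; exact hlt j hj (by omega)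
      · rw [hj', tcB, add_zero]; linarith [Real.pi_pos]) (by
      intro j hj
      rw [tcB, tcA j (by omega)]
      exact hgt j (by omega)) (by rw [tcB, tcA 0 (by omega), add_zero]) (by
      intro i j hij hj
      rw [Set.disjoint_left]
      intro y hy hy'
      rw [segment_eq_image'] at hy hy'
      obtain ⟨τ, ⟨a0, a1⟩, rfl⟩ := hy
      obtain ⟨τ', ⟨b0, b1⟩, he⟩ := hy'
      simp only [Complex.real_smul] at he
      obtain ⟨k0, k1, k2⟩ := hpt i (by omega) τ a0 a1
      obtain ⟨l0, l1, l2⟩ := hpt j hj τ' b0 b1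
      rw [k2, l2] at he
      exact h.edges_disj (i := M + i) (j := M + j) (by omega) (by omega) k0 k1 l0 l1
        (by linear_combination -he)) (by
      intro i hi
      obtain ⟨r0, r1, re⟩ := hr i hi
      rw [re]
      exact mul_ne_zero (by exact_mod_cast r0.ne') (h.ne _)) (by
      intro i hi a ha he
      obtain ⟨r0, r1, re⟩ := hr i (by omega)
      obtain ⟨q0, q1, qe⟩ := hr (i+1) hi
      rw [show i + 2 = i + 1 + 1 from rfl, re, qe] at he
      refine h.opp (M+i) (a * r i / r (i+1)) (div_neg_of_neg_of_pos (mul_neg_of_neg_of_pos ha r0) q0) ?_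
      have : (r (i+1) : ℂ) ≠ 0 := by exact_mod_cast q0.ne'
      push_cast
      field_simp
      rw [show M + (i + 1) = M + i + 1 by ring] at he
      rw [show M + i + 2 = M + i + 1 + 1 by ring]
      linear_combination he)
  refine lt_of_eq_of_lt ?_ hmain
  apply Finset.sum_congr rfl
  intro i hi
  rw [Finset.mem_range] at hi
  obtain ⟨r0, r1, re⟩ := hr i (by omega)
  obtain ⟨q0, q1, qe⟩ := hr (i+1) (by omega)
  rw [show i + 2 = i + 1 + 1 from rfl, re, qe, show M + (i + 1) = M + i + 1 by ring,
    show M + i + 2 = M + i + 1 + 1 by ring]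
  have : (r (i+1) * (V (M+i+1+1) - V (M+i+1)) / (r i * (V (M+i+1) - V (M+i))) : ℂ) =
      ((r (i+1) / r i : ℝ) : ℂ) * ((V (M+i+1+1) - V (M+i+1)) / (V (M+i+1) - V (M+i))) := by
    push_cast; rw [mul_div_mul_comm]
  rw [this, Complex.arg_real_mul _ (div_pos q0 r0)]

theorem main (h : XiPoly K n V) {x : ℂ} (hx : x ∉ K) {β : ℝ} (hβ0 : 0 ≤ β) (hβ1 : β < π)
    (hrot : ∀ i m, m + 1 ≤ n →
      -β ≤ ∑ j ∈ Finset.range m, Complex.arg ((V (i+j+2) - V (i+j+1)) / (V (i+j+1) - V (i+j)))) :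
    ∃ u v : ℂ, u ≠ 0 ∧ v ≠ 0 ∧ Complex.arg (v / u) = π - β ∧
      ∀ a b : ℝ, 0 ≤ a → 0 ≤ b → x + (a * u + b * v) ∉ K := by
  have hper : Function.Periodic (xith (fun j => V j - x)) n := fun i => h.th_per hx i
  have hne : (Finset.range n).Nonempty := ⟨0, Finset.mem_range.2 h.hn⟩
  obtain ⟨M, hM, hMmax⟩ := Finset.exists_max_image (Finset.range n) (xith (fun j => V j - x)) hne
  obtain ⟨m, hm, hmmin⟩ := Finset.exists_min_image (Finset.range n) (xith (fun j => V j - x)) hne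
  have hmod : ∀ i, i % n ∈ Finset.range n := fun i => Finset.mem_range.2 (Nat.mod_lt _ h.hn)
  have hmax : ∀ i, xith (fun j => V j - x) i ≤ xith (fun j => V j - x) M := fun i => by
    rw [← hper.map_mod_nat i]; exact hMmax _ (hmod i)
  have hmin : ∀ i, xith (fun j => V j - x) m ≤ xith (fun j => V j - x) i := fun i => by
    rw [← hper.map_mod_nat i]; exact hmmin _ (hmod i)
  by_cases hs : xith (fun j => V j - x) M - xith (fun j => V j - x) m < π + β
  · exact h.region_small hx hβ0 hβ1 hmin hmax hs
  exfalso
  push Not at hs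
  set θ := xith (fun j => V j - x) with hθ
  have hex : ∃ d, ∃ M', (θ M' = θ M) ∧ θ (M' + d) ≤ θ M - (π + β) := by
    refine ⟨m + n * M - M, M, rfl, ?_⟩
    have hn := h.hn
    have : M ≤ n * M := Nat.le_mul_of_pos_left _ hn
    rw [show M + (m + n * M - M) = m + n * M by omega, hθ, h.th_per_mul hx]
    linarith
  classical
  obtain ⟨M', hM', hd⟩ := Nat.find_spec hex
  have hmn := fun k hk => Nat.find_min hex (m := k) hk
  set d := Nat.find hex with hdd
  have hd0 : d ≠ 0 := by
    intro h0; rw [h0, add_zero, hM'] at hd; linarith [Real.pi_pos]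
  have hdn : d < n := by
    by_contra hc
    refine hmn (d - n) (by have := h.hn; omega) ⟨M', hM', ?_⟩
    rw [hθ, ← h.th_per hx, show M' + (d - n) + n = M' + d by omega]
    exact hd
  obtain ⟨b, hb⟩ := Nat.exists_eq_succ_of_ne_zero hd0
  rw [hb] at hmn hd hdn
  have := h.big_rot hx hβ0 hβ1 M' b hdn (fun j => by rw [← hθ, hM']; exact hmax j)
    (by
      intro j hj hjb
      rw [← hθ, hM']
      refine lt_of_le_of_ne (hmax _) ?_
      intro he
      refine hmn (b + 1 - j) (by omega) ⟨M' + j, he, ?_⟩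
      rw [show M' + j + (b + 1 - j) = M' + (b + 1) by omega]
      exact hd)
    (by
      intro j hj
      rw [← hθ, hM']
      by_contra hc
      exact hmn j (by omega) ⟨M', hM', not_lt.1 hc⟩)
    (by rw [← hθ, hM']; exact hd)
  have h2 := hrot M' b (by omega)
  linarith

end XiPoly

def xie : (ℝ × ℝ) ≃L[ℝ] ℂ := Complex.equivRealProdCLM.symm

lemma xie_apply (p : ℝ × ℝ) : xie p = p.1 + p.2 * Complex.I := by
  unfold xie
  exact Complex.equivRealProdCLM_symm_apply p

lemma xie_smul (a : ℝ) (p : ℝ × ℝ) : xie (a • p) = a * xie p := by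
  rw [map_smul, Complex.real_smul]

lemma xi_vangle (v w : ℝ × ℝ) : vangle v w = Complex.arg (xie w / xie v) := by
  rw [xie_apply, xie_apply]; rfl

lemma xi_floor (k : ℕ) {t : ℝ} (h0 : 0 ≤ t) (h1 : t < 1) : ⌊((k : ℝ) + t)⌋ = (k : ℤ) := by
  rw [Int.floor_eq_iff]; push_cast; constructor <;> linarith

def xish (s : List (ℝ × ℝ)) (i : ℕ) : ℝ × ℝ := s.getD (i % s.length) 0

lemma xi_rot (l : List (ℝ × ℝ)) : rotShifts l =
    ∑ j ∈ Finset.range (l.length - 1), vangle (l.getD j 0) (l.getD (j+1) 0) := by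
  induction l with
  | nil => simp [rotShifts]
  | cons v l ih =>
    cases l with
    | nil => simp [rotShifts]
    | cons w l =>
      rw [rotShifts, ih]
      simp only [List.length_cons, Nat.add_sub_cancel]
      rw [Finset.sum_range_succ']
      rw [add_comm]
      rfl

lemma xish_append (s : List (ℝ × ℝ)) (k : ℕ) (hk : k < 2 * s.length) :
    (s ++ s).getD k 0 = xish s k := by
  unfold xish
  rcases lt_or_ge k s.length with h | h
  · rw [Nat.mod_eq_of_lt h, List.getD_append _ _ _ _ h]
  · rw [List.getD_append_right _ _ _ _ h, Nat.mod_eq_sub_mod h, Nat.mod_eq_of_lt (by omega)]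

lemma xish_mod (s : List (ℝ × ℝ)) (i j : ℕ) : xish s (i % s.length + j) = xish s (i + j) := by
  unfold xish
  rw [Nat.mod_add_mod]

lemma xi_bdd (s : List (ℝ × ℝ)) :
    BddBelow (rotShifts '' { t : List (ℝ × ℝ) | t.length ≤ s.length ∧ t <:+: (s ++ s) }) := by
  apply Set.Finite.bddBelow
  apply Set.Finite.image
  refine Set.Finite.subset (List.finite_toSet (s ++ s).sublists) ?_
  rintro t ⟨_, ht⟩
  exact List.mem_sublists.2 ht.sublist

lemma xi_aco_nonpos (s : List (ℝ × ℝ)) : acoClosed s ≤ 0 := by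
  unfold acoClosed
  refine csInf_le (xi_bdd s) ⟨[], ⟨by simp, ⟨[], s ++ s, by simp⟩⟩, rfl⟩

lemma xi_aco_le (s : List (ℝ × ℝ)) (i m : ℕ) (hm : m + 1 ≤ s.length) :
    acoClosed s ≤ ∑ j ∈ Finset.range m, vangle (xish s (i + j)) (xish s (i + j + 1)) := by
  have hlt : i % s.length < s.length := Nat.mod_lt _ (by omega)
  have hlen : (((s ++ s).drop (i % s.length)).take (m+1)).length = m + 1 := by
    simp; omega
  unfold acoClosed
  refine csInf_le (xi_bdd s) ⟨((s ++ s).drop (i % s.length)).take (m+1), ⟨by rw [hlen]; exact hm, ?_⟩, ?_⟩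
  · exact ⟨(s ++ s).take (i % s.length), ((s ++ s).drop (i % s.length)).drop (m+1), by simp⟩
  · rw [xi_rot, hlen, Nat.add_sub_cancel]
    have key : ∀ j, j ≤ m → (((s ++ s).drop (i % s.length)).take (m+1)).getD j 0 = xish s (i + j) := by
      intro j hj
      rw [← xish_mod, ← xish_append s _ (by omega)]
      simp only [List.getD_eq_getElem?_getD, List.getElem?_take, List.getElem?_drop]
      rw [if_pos (by omega)]
    apply Finset.sum_congr rfl
    intro j hj
    rw [Finset.mem_range] at hj
    rw [key j hj.le, key (j+1) (by omega), add_assoc]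

section
variable {K : Set (ℝ × ℝ)} {P : Polyline}

def xiV (P : Polyline) (i : ℕ) : ℂ := xie (P.vert (i % P.shifts.length))

lemma xi_pos (hK : IsSimplePolygon K P) : 0 < P.shifts.length :=
  List.length_pos_iff.2 hK.proper.1

lemma xi_vert_len (hK : IsSimplePolygon K P) : P.vert P.shifts.length = P.vert 0 := by
  have : P.shifts.sum = 0 := hK.simpleClosed.1
  simp [Polyline.vert, this]

lemma xi_vert_succ {i : ℕ} (hi : i < P.shifts.length) :
    P.vert (i+1) = P.vert i + P.shifts.getD i 0 := by
  unfold Polyline.vert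
  rw [List.sum_take_succ _ _ hi, List.getD_eq_getElem _ _ hi, add_assoc]

lemma xiV_eq (hK : IsSimplePolygon K P) {i : ℕ} (hi : i ≤ P.shifts.length) : xiV P i = xie (P.vert i) := by
  unfold xiV
  rcases hi.lt_or_eq with h | h
  · rw [Nat.mod_eq_of_lt h]
  · rw [h, Nat.mod_self, xi_vert_len hK]

lemma xiV_mod (i : ℕ) : xiV P (i % P.shifts.length) = xiV P i := by
  unfold xiV; rw [Nat.mod_mod]

lemma xiV_sub (hK : IsSimplePolygon K P) (i : ℕ) : xiV P (i+1) - xiV P i = xie (xish P.shifts i) := by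
  have hlt : i % P.shifts.length < P.shifts.length := Nat.mod_lt _ (xi_pos hK)
  have e1 : xiV P (i+1) = xiV P (i % P.shifts.length + 1) := by
    unfold xiV; rw [Nat.mod_add_mod]
  rw [e1, ← xiV_mod i, xiV_eq hK hlt.le, xiV_eq hK hlt, xi_vert_succ hlt, map_add, add_sub_cancel_left]
  rfl

lemma xish_ne (hK : IsSimplePolygon K P) (i : ℕ) : xish P.shifts i ≠ 0 := by
  have hlt : i % P.shifts.length < P.shifts.length := Nat.mod_lt _ (xi_pos hK)
  unfold xish
  rw [List.getD_eq_getElem _ _ hlt]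
  exact hK.proper.2 _ (List.getElem_mem _)

lemma xi_param (hK : IsSimplePolygon K P) (i : ℕ) {t : ℝ} (h0 : 0 ≤ t) (h1 : t < 1) :
    xie (P.param ((i % P.shifts.length : ℕ) + t)) = xiV P i + t * (xiV P (i+1) - xiV P i) := by
  rw [xiV_sub hK]
  have hf : ⌊(((i % P.shifts.length : ℕ) : ℝ) + t)⌋ = ((i % P.shifts.length : ℕ) : ℤ) := by
    exact xi_floor _ h0 h1
  have hfr : Int.fract (((i % P.shifts.length : ℕ) : ℝ) + t) = t := by
    unfold Int.fract; rw [hf, Int.cast_natCast]; ring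
  unfold Polyline.param
  rw [hf, hfr, map_add, xie_smul]
  rfl

lemma xi_opp (hK : IsSimplePolygon K P) (i : ℕ) : ¬ Opp (xish P.shifts i) (xish P.shifts (i+1)) := by
  have hp := xi_pos hK
  have hlt : i % P.shifts.length < P.shifts.length := Nat.mod_lt _ hp
  have hc : List.IsChain (fun v w => ¬ Opp v w) (P.shifts ++ P.shifts.take 1) := hK.nonReverse
  rw [List.isChain_iff_getElem] at hc
  have hlen : (P.shifts ++ P.shifts.take 1).length = P.shifts.length + 1 := by
    simp; omega
  have := hc (i % P.shifts.length) (by rw [hlen]; omega)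
  have k1 : ∀ h, (P.shifts ++ P.shifts.take 1)[i % P.shifts.length]'h = xish P.shifts i := by
    intro h
    rw [List.getElem_append_left hlt]
    unfold xish
    rw [List.getD_eq_getElem _ _ hlt]
  have k2 : ∀ h, (P.shifts ++ P.shifts.take 1)[i % P.shifts.length + 1]'h = xish P.shifts (i+1) := by
    intro h
    rw [← xish_mod]
    unfold xish
    rcases lt_or_ge (i % P.shifts.length + 1) P.shifts.length with h2 | h2
    · rw [List.getElem_append_left h2, Nat.mod_eq_of_lt h2, List.getD_eq_getElem _ _ h2]
    · have h3 : i % P.shifts.length + 1 = P.shifts.length := by omega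
      rw [List.getElem_append_right h2]
      simp [h3, List.getElem?_eq_getElem hp]
  rwa [k1, k2] at this

lemma xi_poly (hK : IsSimplePolygon K P) : XiPoly (xie '' K) P.shifts.length (xiV P) := by
  have hp := xi_pos hK
  refine ⟨hp, hK.compact.image xie.continuous, ?_, ?_, ?_, ?_, ?_, ?_⟩
  · have e1 := xie.toHomeomorph.image_interior K
    have e2 := xie.toHomeomorph.image_closure (interior K)
    simp only [ContinuousLinearEquiv.coe_toHomeomorph] at e1 e2
    rw [← e1, ← e2, ← hK.regular]
  · intro i; unfold xiV; rw [Nat.add_mod_right]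
  · intro i
    rw [xiV_sub hK]
    intro h0
    exact xish_ne hK i (by simpa using h0)
  · intro i a ha he
    rw [show i + 2 = (i+1) + 1 from rfl, xiV_sub hK, xiV_sub hK, ← xie_smul] at he
    exact xi_opp hK i ⟨a, ha, xie.injective he⟩
  · intro i j t t' h0 h1 h0' h1' he
    rw [← xi_param hK i h0 h1, ← xi_param hK j h0' h1'] at he
    have hi : i % P.shifts.length < P.shifts.length := Nat.mod_lt _ hp
    have hj : j % P.shifts.length < P.shifts.length := Nat.mod_lt _ hp
    have hi' : ((i % P.shifts.length : ℕ) : ℝ) + 1 ≤ P.shifts.length := by exact_mod_cast hi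
    have hj' : ((j % P.shifts.length : ℕ) : ℝ) + 1 ≤ P.shifts.length := by exact_mod_cast hj
    have e := hK.simpleClosed.2 ⟨by positivity, by linarith⟩ ⟨by positivity, by linarith⟩ (xie.injective he)
    have hfl : ⌊(((i % P.shifts.length : ℕ) : ℝ) + t)⌋ = ((i % P.shifts.length : ℕ) : ℤ) := by
      exact xi_floor _ h0 h1
    have hfl' : ⌊(((j % P.shifts.length : ℕ) : ℝ) + t')⌋ = ((j % P.shifts.length : ℕ) : ℤ) := by
      exact xi_floor _ h0' h1'
    have : i % P.shifts.length = j % P.shifts.length := by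
      rw [e, hfl'] at hfl; exact_mod_cast hfl.symm
    refine ⟨this, ?_⟩
    rw [this] at e; linarith
  · have e1 := xie.toHomeomorph.image_frontier K
    simp only [ContinuousLinearEquiv.coe_toHomeomorph] at e1
    rw [← e1, hK.boundary]
    have hvert : ∀ k : ℕ, k ≤ P.shifts.length → xie (P.param k) = xiV P k := by
      intro k hk
      rw [xiV_eq hK hk]
      simp [Polyline.param]
    ext y
    constructor
    · rintro ⟨_, ⟨τ, ⟨t0, t1⟩, rfl⟩, rfl⟩
      rcases t1.lt_or_eq with t1 | t1
      · have hfl : (⌊τ⌋.toNat : ℤ) = ⌊τ⌋ := Int.toNat_of_nonneg (Int.floor_nonneg.2 t0)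
        have hfl2 : ((⌊τ⌋.toNat : ℕ) : ℝ) = (⌊τ⌋ : ℝ) := by exact_mod_cast hfl
        have hlt : ⌊τ⌋.toNat < P.shifts.length := by
          have : ((⌊τ⌋.toNat : ℕ) : ℝ) < P.shifts.length := by
            rw [hfl2]; exact lt_of_le_of_lt (Int.floor_le τ) t1
          exact_mod_cast this
        refine ⟨⌊τ⌋.toNat, hlt, Int.fract τ, Int.fract_nonneg _, (Int.fract_lt_one _).le, ?_⟩
        rw [← xi_param hK _ (Int.fract_nonneg _) (Int.fract_lt_one _), Nat.mod_eq_of_lt hlt, hfl2,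
          Int.floor_add_fract]
      · refine ⟨P.shifts.length - 1, by omega, 1, by norm_num, le_rfl, ?_⟩
        rw [t1, hvert _ le_rfl, Nat.sub_add_cancel hp]
        push_cast; ring
    · rintro ⟨i, hi, t, h0, h1, rfl⟩
      have hi' : (i : ℝ) + 1 ≤ P.shifts.length := by exact_mod_cast hi
      rcases h1.lt_or_eq with h1 | h1
      · refine ⟨_, ⟨(i : ℝ) + t, ⟨by positivity, by linarith⟩, rfl⟩, ?_⟩
        have := xi_param hK i h0 h1
        rwa [Nat.mod_eq_of_lt hi] at this
      · refine ⟨_, ⟨((i + 1 : ℕ) : ℝ), ⟨by positivity, by exact_mod_cast hi⟩, rfl⟩, ?_⟩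
        rw [hvert _ hi, h1]; push_cast; ring

end

theorem angular_separation (K : Set (ℝ × ℝ)) (P : Polyline)
    (hK : IsSimplePolygon K P) (haco : -π < acoClosed P.shifts) :
    ∀ x ∉ K, ∃ u v : ℝ × ℝ, u ≠ 0 ∧ v ≠ 0 ∧
      |vangle u v| = π + acoClosed P.shifts ∧
      angularRegion x u v ∩ K = ∅ := by
  intro x hx
  have hx' : xie x ∉ xie '' K := by
    rintro ⟨y, hy, he⟩
    exact hx (xie.injective he ▸ hy)
  obtain ⟨u, v, hu, hv, harg, hreg⟩ := (xi_poly hK).main hx' (β := -acoClosed P.shifts)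
    (by linarith [xi_aco_nonpos P.shifts]) (by linarith) (by
      intro i m hm
      rw [neg_neg]
      refine (xi_aco_le P.shifts i m hm).trans_eq ?_
      apply Finset.sum_congr rfl
      intro j _
      rw [show i + j + 2 = (i + j + 1) + 1 from rfl, xiV_sub hK, xiV_sub hK, xi_vangle])
  refine ⟨xie.symm u, xie.symm v, by simpa using hu, by simpa using hv, ?_, ?_⟩
  · rw [xi_vangle, ContinuousLinearEquiv.apply_symm_apply, ContinuousLinearEquiv.apply_symm_apply,
      harg, abs_of_nonneg (by linarith), sub_neg_eq_add]
  · rw [Set.eq_empty_iff_forall_notMem]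
    rintro y ⟨hy, hyK⟩
    have hsub : angularRegion x (xie.symm u) (xie.symm v) ⊆
        {y | ∃ a b : ℝ, 0 ≤ a ∧ 0 ≤ b ∧ y = x + (a • xie.symm u + b • xie.symm v)} := by
      apply convexHull_min
      · rintro y (⟨t, ht, rfl⟩ | ⟨t, ht, rfl⟩)
        · exact ⟨t, 0, ht, le_rfl, by simp⟩
        · exact ⟨0, t, le_rfl, ht, by simp⟩
      · rintro _ ⟨a, b, ha, hb, rfl⟩ _ ⟨a', b', ha', hb', rfl⟩ r r' hr hr' hrr
        refine ⟨r * a + r' * a', r * b + r' * b', by positivity, by positivity, ?_⟩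
        have : r' = 1 - r := by linarith
        subst this
        module
    obtain ⟨a, b, ha, hb, rfl⟩ := hsub hy
    apply hreg a b ha hb
    refine ⟨_, hyK, ?_⟩
    simp only [map_add, xie_smul, ContinuousLinearEquiv.apply_symm_apply]
end
end

section
/- Let P and Q be non-reverse polylines satisfying the hypotheses of the sorted sum (first shifts of the same direction and rot P = rot Q), with piecewise-linear parameterizations p, q : [0,1] → ℝ². Then there exist non-decreasing piecewise-linear surjective functions φ, ψ : [0,1] → [0,1] such that r(t) = p(φ(t)) + q(ψ(t)) is a parameterization of R = P +ₛ Q; in particular P +ₛ Q ⊆ P + Q, the Minkowski sum of P and Q as subsets of the plane. -/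
open Real Set Pointwise

noncomputable section

/-- `f` is piecewise affine on `[a, b]` : there is a finite nondecreasing
subdivision of `[a, b]` on each piece of which `f` is affine. -/
def PiecewiseAffineOn {E : Type*} [AddCommGroup E] [Module ℝ E]
    (f : ℝ → E) (a b : ℝ) : Prop :=
  ∃ n : ℕ, ∃ u : ℕ → ℝ, u 0 = a ∧ u n = b ∧ (∀ i < n, u i ≤ u (i + 1)) ∧
    ∀ i < n, ∃ c d : E, ∀ t ∈ Set.Icc (u i) (u (i + 1)), f t = t • c + d

/-- `f : [0,1] → ℝ²` is a parameterization of the polyline `P` : it is the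
natural parameterization of `P` composed with a monotone surjective change of
parameter `[0,1] → [0, number of edges]`. -/
def IsParamOf (P : Polyline) (f : ℝ → ℝ × ℝ) : Prop :=
  ∃ σ : ℝ → ℝ, MonotoneOn σ (Set.Icc 0 1) ∧
    σ '' Set.Icc 0 1 = Set.Icc 0 (P.shifts.length : ℝ) ∧
    ∀ t ∈ Set.Icc (0 : ℝ) 1, f t = P.param (σ t)

theorem sp_merge_cons (a : ℝ × ℝ) (s : List (ℝ × ℝ)) (b : ℝ × ℝ) (t : List (ℝ × ℝ)) :
    sortedMerge (a :: s) (b :: t) =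
      if rotShifts (b :: t) ≤ rotShifts (a :: s) then a :: sortedMerge s (b :: t)
      else b :: sortedMerge (a :: s) t := by
  rw [sortedMerge]

/-- `r` is an interleaving of `s` and `t`, with position functions `f`, `g`. -/
def SPInter (s t r : List (ℝ × ℝ)) (f g : ℕ → ℕ) : Prop :=
  f 0 = 0 ∧ g 0 = 0 ∧ Monotone f ∧ Monotone g ∧ f r.length = s.length ∧ g r.length = t.length ∧
  ∀ k < r.length,
    (f (k + 1) = f k + 1 ∧ g (k + 1) = g k ∧ r.getD k 0 = s.getD (f k) 0) ∨
    (g (k + 1) = g k + 1 ∧ f (k + 1) = f k ∧ r.getD k 0 = t.getD (g k) 0)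

theorem SPInter.symm {s t r : List (ℝ × ℝ)} {f g : ℕ → ℕ} (h : SPInter s t r f g) :
    SPInter t s r g f := by
  obtain ⟨h1, h2, h3, h4, h5, h6, h7⟩ := h
  exact ⟨h2, h1, h4, h3, h6, h5, fun k hk => (h7 k hk).symm⟩

theorem SPInter.cons {s t r : List (ℝ × ℝ)} {f g : ℕ → ℕ} (h : SPInter s t r f g) (a : ℝ × ℝ) :
    ∃ f' g', SPInter (a :: s) t (a :: r) f' g' := by
  obtain ⟨h1, h2, h3, h4, h5, h6, h7⟩ := h
  refine ⟨fun k => Nat.casesOn k 0 (fun k => f k + 1), fun k => g (k - 1), rfl, by simpa using h2,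
    ?_, ?_, by simp [h5], by simp [h6], ?_⟩
  · apply monotone_nat_of_le_succ
    rintro (_ | k)
    · simp
    · have := h3 (Nat.le_succ k)
      simpa using this
  · intro x y hxy
    exact h4 (by omega)
  · rintro (_ | k) hk
    · left; simp [h1]
    · have := h7 k (by simpa using hk)
      simpa using this

theorem sp_inter_nil (t : List (ℝ × ℝ)) : SPInter [] t t (fun _ => 0) id :=
  ⟨rfl, rfl, fun _ _ _ => le_rfl, fun _ _ h => h, rfl, rfl, fun _ _ => Or.inr ⟨rfl, rfl, rfl⟩⟩

theorem sp_inter_merge (N : ℕ) : ∀ s t : List (ℝ × ℝ), s.length + t.length = N →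
    ∃ f g, SPInter s t (sortedMerge s t) f g := by
  induction N with
  | zero =>
    intro s t h
    have hs : s = [] := List.length_eq_zero_iff.1 (by omega)
    have : sortedMerge s t = t := by rw [hs, sortedMerge]
    rw [this, hs]
    exact ⟨_, _, sp_inter_nil t⟩
  | succ N ih =>
    intro s t h
    match s, t with
    | [], t =>
      rw [sortedMerge]
      exact ⟨_, _, sp_inter_nil t⟩
    | a :: s, [] =>
      rw [sortedMerge]
      · exact ⟨_, _, (sp_inter_nil (a :: s)).symm⟩
      · simp
    | a :: s, b :: t =>
      rw [sp_merge_cons]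
      split_ifs
      · obtain ⟨f, g, hfg⟩ := ih s (b :: t) (by simp at h ⊢; omega)
        exact hfg.cons a
      · obtain ⟨f, g, hfg⟩ := ih (a :: s) t (by simp at h ⊢; omega)
        obtain ⟨f', g', h'⟩ := hfg.symm.cons b
        exact ⟨g', f', h'.symm⟩

theorem sp_take_succ (l : List (ℝ × ℝ)) (k : ℕ) :
    (l.take (k + 1)).sum = (l.take k).sum + l.getD k 0 := by
  induction l generalizing k with
  | nil => simp
  | cons a l ih =>
    cases k with
    | zero => simp
    | succ k => 
      simp only [List.take_succ_cons, List.sum_cons, List.getD_cons_succ]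
      rw [ih, add_assoc]

theorem SPInter.add_eq {s t r : List (ℝ × ℝ)} {f g : ℕ → ℕ} (h : SPInter s t r f g) (k : ℕ)
    (hk : k ≤ r.length) : f k + g k = k ∧
    (r.take k).sum = (s.take (f k)).sum + (t.take (g k)).sum := by
  obtain ⟨h1, h2, h3, h4, h5, h6, h7⟩ := h
  induction k with
  | zero => simp [h1, h2]
  | succ k ih =>
    obtain ⟨e1, e2⟩ := ih (by omega)
    rcases h7 k (by omega) with ⟨a, b, c⟩ | ⟨a, b, c⟩
    · refine ⟨by omega, ?_⟩
      rw [a, b, sp_take_succ, sp_take_succ, c, e2]; abel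
    · refine ⟨by omega, ?_⟩
      rw [a, b, sp_take_succ, sp_take_succ, c, e2]; abel

theorem sp_cases {k : ℕ} {t : ℝ} (h1 : (k : ℝ) ≤ t) (h2 : t ≤ k + 1) :
    (⌊t⌋ = (k : ℤ) ∧ Int.fract t = t - k) ∨ (⌊t⌋ = ((k + 1 : ℕ) : ℤ) ∧ Int.fract t = 0 ∧ t = k + 1) := by
  rcases h2.lt_or_eq with h | h
  · left
    have : ⌊t⌋ = (k : ℤ) := Int.floor_eq_iff.2 ⟨by simpa using h1, by simpa using h⟩
    exact ⟨this, by rw [Int.fract, this]; simp⟩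
  · right
    have : ⌊t⌋ = ((k + 1 : ℕ) : ℤ) := by
      rw [h]; exact_mod_cast Int.floor_natCast (R := ℝ) (k + 1)
    exact ⟨this, by rw [Int.fract, this, h]; simp, h⟩

theorem sp_param (P : Polyline) {k : ℕ} {t : ℝ} (h1 : (k : ℝ) ≤ t) (h2 : t ≤ k + 1) :
    P.param t = P.vert k + (t - k) • P.shifts.getD k 0 := by
  rcases sp_cases h1 h2 with ⟨a, b⟩ | ⟨a, b, c⟩
  · rw [Polyline.param, a, b]; simp
  · rw [Polyline.param, a, b, c]
    simp only [Int.toNat_natCast, zero_smul, add_zero, Polyline.vert, sp_take_succ]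
    simp [add_assoc]

/-- Linear interpolation of a sequence. -/
def spInterp (c : ℕ → ℝ) (t : ℝ) : ℝ :=
  c ⌊t⌋.toNat + Int.fract t * (c (⌊t⌋.toNat + 1) - c ⌊t⌋.toNat)

theorem spInterp_eq (c : ℕ → ℝ) {k : ℕ} {t : ℝ} (h1 : (k : ℝ) ≤ t) (h2 : t ≤ k + 1) :
    spInterp c t = c k + (t - k) * (c (k + 1) - c k) := by
  rcases sp_cases h1 h2 with ⟨a, b⟩ | ⟨a, b, c⟩
  · rw [spInterp, a, b]; simp
  · rw [spInterp, a, b, c]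
    simp

theorem spInterp_nat (c : ℕ → ℝ) (k : ℕ) : spInterp c k = c k := by
  rw [spInterp_eq c (le_refl (k : ℝ)) (by linarith)]; simp

theorem spInterp_mem {c : ℕ → ℝ} (hc : Monotone c) {k : ℕ} {t : ℝ} (h1 : (k : ℝ) ≤ t)
    (h2 : t ≤ k + 1) : c k ≤ spInterp c t ∧ spInterp c t ≤ c (k + 1) := by
  have := hc (Nat.le_succ k)
  rw [spInterp_eq c h1 h2]
  constructor <;> nlinarith

theorem spInterp_mono {c : ℕ → ℝ} (hc : Monotone c) : MonotoneOn (spInterp c) (Ici 0) := by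
  intro s hs t ht hst
  have hs' := Nat.floor_le (mem_Ici.1 hs)
  have hs2 := (Nat.lt_floor_add_one s).le
  have ht' := Nat.floor_le (mem_Ici.1 ht)
  have ht2 := (Nat.lt_floor_add_one t).le
  rcases (Nat.floor_mono hst).lt_or_eq with h | h
  · exact ((spInterp_mem hc hs' hs2).2.trans (hc h)).trans (spInterp_mem hc ht' ht2).1
  · rw [← h] at ht' ht2
    rw [spInterp_eq c hs' hs2, spInterp_eq c ht' ht2]
    have := hc (Nat.le_succ ⌊s⌋₊)
    simp only [Nat.succ_eq_add_one] at this
    nlinarith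

theorem sp_scaled_pa (c : ℕ → ℝ) {N : ℕ} (hN : 0 < N) :
    PiecewiseAffineOn (fun t => spInterp c (N * t)) 0 1 := by
  have hN' : (0 : ℝ) < N := by exact_mod_cast hN
  refine ⟨N, fun k => k / N, by simp, by field_simp, fun i _ => ?_, fun i _ => ?_⟩
  · show (i : ℝ) / N ≤ ((i + 1 : ℕ) : ℝ) / N
    gcongr; simp
  · refine ⟨N * (c (i + 1) - c i), c i - i * (c (i + 1) - c i), fun t ht => ?_⟩
    obtain ⟨h1, h2⟩ := ht
    rw [div_le_iff₀ hN'] at h1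
    rw [le_div_iff₀ hN'] at h2
    push_cast at h2
    show spInterp c (N * t) = _
    rw [spInterp_eq c (k := i) (by linarith) (by linarith), smul_eq_mul]
    ring

theorem sp_pa_cont {f : ℝ → ℝ} {a b : ℝ} (h : PiecewiseAffineOn f a b) :
    ContinuousOn f (Icc a b) := by
  obtain ⟨n, u, rfl, rfl, hm, ha⟩ := h
  have key : ∀ k ≤ n, u 0 ≤ u k ∧ ContinuousOn f (Icc (u 0) (u k)) := by
    intro k
    induction k with
    | zero => intro _; exact ⟨le_rfl, by simp⟩
    | succ k ih =>
      intro hk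
      obtain ⟨i1, i2⟩ := ih (by omega)
      have h3 := hm k (by omega)
      refine ⟨i1.trans h3, ?_⟩
      rw [← Icc_union_Icc_eq_Icc i1 h3]
      refine i2.union_of_isClosed ?_ isClosed_Icc isClosed_Icc
      obtain ⟨c, d, hcd⟩ := ha k (by omega)
      exact (by fun_prop : Continuous fun t : ℝ => t • c + d).continuousOn.congr hcd
  exact (key n le_rfl).2

theorem sp_cont {σ : ℝ → ℝ} {L : ℝ} (hm : MonotoneOn σ (Icc 0 1))
    (hi : σ '' Icc 0 1 = Icc 0 L) : ContinuousOn σ (Icc 0 1) := by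
  have hmaps : ∀ x : Icc (0 : ℝ) 1, σ x ∈ Icc 0 L := fun x => hi ▸ mem_image_of_mem σ x.2
  let F : Icc (0 : ℝ) 1 → Icc (0 : ℝ) L := fun x => ⟨σ x, hmaps x⟩
  have hF : Continuous F := by
    apply Monotone.continuous_of_surjective
    · intro x y hxy
      exact hm x.2 y.2 hxy
    · rintro ⟨y, hy⟩
      rw [← hi] at hy
      obtain ⟨x, hx, rfl⟩ := hy
      exact ⟨⟨x, hx⟩, rfl⟩
  rw [continuousOn_iff_continuous_restrict]
  exact continuous_subtype_val.comp hF

/-- Breakpoints: preimages of the integers under a monotone surjection. -/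
theorem sp_breaks {σ : ℝ → ℝ} {n : ℕ} (hn : 0 < n) (hm : MonotoneOn σ (Icc 0 1))
    (hi : σ '' Icc 0 1 = Icc 0 (n : ℝ)) :
    σ 0 = 0 ∧ σ 1 = n ∧ ∃ x : ℕ → ℝ, Monotone x ∧ x 0 = 0 ∧ x n = 1 ∧ (∀ i, x i ∈ Icc (0 : ℝ) 1) ∧
      ∀ i ≤ n, σ (x i) = i := by
  have z0 : (0 : ℝ) ∈ Icc (0 : ℝ) 1 := by simp
  have z1 : (1 : ℝ) ∈ Icc (0 : ℝ) 1 := by simp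
  have hmaps : ∀ x ∈ Icc (0 : ℝ) 1, σ x ∈ Icc 0 (n : ℝ) := fun x hx => hi ▸ mem_image_of_mem σ hx
  have hs : ∀ y ∈ Icc 0 (n : ℝ), ∃ x ∈ Icc (0 : ℝ) 1, σ x = y := fun y hy => by rwa [← hi] at hy
  have s0 : σ 0 = 0 := by
    obtain ⟨x, hx, e⟩ := hs 0 (by simp)
    exact le_antisymm (e ▸ hm z0 hx hx.1) (hmaps 0 z0).1
  have s1 : σ 1 = n := by
    obtain ⟨x, hx, e⟩ := hs n (by simp)
    exact le_antisymm (hmaps 1 z1).2 (e ▸ hm hx z1 hx.2)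
  have : ∀ i : ℕ, ∃ y ∈ Icc (0 : ℝ) 1, (i ≤ n → σ y = i) ∧ (i = 0 → y = 0) ∧ (n ≤ i → y = 1) := by
    intro i
    rcases Nat.eq_zero_or_pos i with rfl | h0
    · exact ⟨0, z0, fun _ => by simpa using s0, fun _ => rfl, fun h => by omega⟩
    · by_cases h : n ≤ i
      · refine ⟨1, z1, fun h' => ?_, fun h => by omega, fun _ => rfl⟩
        rw [s1, le_antisymm h h']
      · have h' : i ≤ n := by omega
        obtain ⟨x, hx, e⟩ := hs i ⟨by positivity, by exact_mod_cast h'⟩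
        exact ⟨x, hx, fun _ => e, fun h => by omega, fun h'' => absurd h'' h⟩
  choose x hx h1 h2 h3 using this
  refine ⟨s0, s1, x, ?_, h2 0 rfl, h3 n le_rfl, hx, h1⟩
  intro i j hij
  by_cases hj : n ≤ j
  · rw [h3 j hj]; exact (hx i).2
  · rcases hij.lt_or_eq with h | rfl
    · by_contra hc
      push Not at hc
      have := hm (hx j) (hx i) hc.le
      rw [h1 j (by omega), h1 i (by omega)] at this
      have : j ≤ i := by exact_mod_cast this
      omega
    · exact le_rfl

/-- One step of the sorted sum, running along an edge of the first polyline. -/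
theorem sp_step (P Q R : Polyline) {f g : ℕ → ℕ} {k : ℕ} {a b : ℝ} 
    (hk : f k + g k = k) (hv : R.vert k = P.vert (f k) + Q.vert (g k))
    (hr : R.shifts.getD k 0 = P.shifts.getD (f k) 0)
    (ha : (f k : ℝ) ≤ a) (ha' : a ≤ f k + 1) (hb : b = g k) :
    P.param a + Q.param b = R.param (a + b) := by
  have hk' : (f k : ℝ) + g k = k := by exact_mod_cast hk
  subst hb
  rw [sp_param P ha ha', sp_param Q (le_refl (g k : ℝ)) (by linarith),
    sp_param R (k := k) (by linarith) (by linarith), hv, hr]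
  have : a + (g k : ℝ) - k = a - f k := by linarith
  rw [this, sub_self, zero_smul]
  abel

/-- **Lemma (parameterization of the sorted sum).** If `P, Q` satisfy the
sorted-sum hypotheses and have piecewise-linear parameterizations `p, q` on
`[0,1]`, then there are nondecreasing piecewise-linear surjections
`φ, ψ : [0,1] → [0,1]` such that `t ↦ p (φ t) + q (ψ t)` parameterizes
`P +ₛ Q`; in particular `P +ₛ Q ⊆ P + Q` as subsets of the plane. -/
theorem sortedSum_param (P Q : Polyline) (h : SortedSumHyp P Q)
    (p q : ℝ → ℝ × ℝ)
    (hp : IsParamOf P p) (hp' : PiecewiseAffineOn p 0 1)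
    (hq : IsParamOf Q q) (hq' : PiecewiseAffineOn q 0 1) :
    ∃ φ ψ : ℝ → ℝ,
      MonotoneOn φ (Set.Icc 0 1) ∧ MonotoneOn ψ (Set.Icc 0 1) ∧
      PiecewiseAffineOn φ 0 1 ∧ PiecewiseAffineOn ψ 0 1 ∧
      φ '' Set.Icc 0 1 = Set.Icc 0 1 ∧ ψ '' Set.Icc 0 1 = Set.Icc 0 1 ∧
      IsParamOf (sortedSum P Q) (fun t => p (φ t) + q (ψ t)) ∧
      (sortedSum P Q).trace ⊆ P.trace + Q.trace := by
  obtain ⟨⟨hP, -⟩, ⟨hQ, -⟩, -⟩ := h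
  obtain ⟨σ, hσm, hσi, hσ⟩ := hp
  obtain ⟨ρ, hρm, hρi, hρ⟩ := hq
  have hn : 0 < P.shifts.length := List.length_pos_iff.2 hP
  have hm : 0 < Q.shifts.length := List.length_pos_iff.2 hQ
  obtain ⟨σ0, σ1, x, xm, x0, x1, xI, hx⟩ := sp_breaks hn hσm hσi
  obtain ⟨ρ0, ρ1, y, ym, y0, y1, yI, hy⟩ := sp_breaks hm hρm hρi
  obtain ⟨f, g, hfg⟩ := sp_inter_merge _ P.shifts Q.shifts rfl
  have hadd := hfg.add_eq
  obtain ⟨f0, g0, fm, gm, fN, gN, hstep⟩ := hfg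
  set R := sortedSum P Q with hR
  have hRs : R.shifts = sortedMerge P.shifts Q.shifts := rfl
  rw [← hRs] at hadd fN gN hstep
  set N := R.shifts.length with hNdef
  have hNsum : P.shifts.length + Q.shifts.length = N := by
    have := (hadd N le_rfl).1
    omega
  have hN : 0 < N := by omega
  have hN' : (0 : ℝ) < N := by exact_mod_cast hN
  have cxm : Monotone (fun k => x (f k)) := fun a b hab => xm (fm hab)
  have cym : Monotone (fun k => y (g k)) := fun a b hab => ym (gm hab)
  let φ : ℝ → ℝ := fun t => spInterp (fun k => x (f k)) (N * t)
  let ψ : ℝ → ℝ := fun t => spInterp (fun k => y (g k)) (N * t)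
  have hscale : ∀ c : ℕ → ℝ, Monotone c → MonotoneOn (fun t => spInterp c (N * t)) (Icc 0 1) := by
    intro c hc a ha b hb hab
    refine spInterp_mono hc (mem_Ici.2 (mul_nonneg hN'.le ha.1)) (mem_Ici.2 (mul_nonneg hN'.le hb.1)) ?_
    gcongr
  have φm : MonotoneOn φ (Icc 0 1) := hscale _ cxm
  have ψm : MonotoneOn ψ (Icc 0 1) := hscale _ cym
  have φpa : PiecewiseAffineOn φ 0 1 := sp_scaled_pa _ hN
  have ψpa : PiecewiseAffineOn ψ 0 1 := sp_scaled_pa _ hN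
  have φ0 : φ 0 = 0 := by
    have := spInterp_nat (fun k => x (f k)) 0
    simpa [φ, f0, x0] using this
  have ψ0 : ψ 0 = 0 := by
    have := spInterp_nat (fun k => y (g k)) 0
    simpa [ψ, g0, y0] using this
  have φ1 : φ 1 = 1 := by
    have := spInterp_nat (fun k => x (f k)) N
    simpa [φ, fN, x1] using this
  have ψ1 : ψ 1 = 1 := by
    have := spInterp_nat (fun k => y (g k)) N
    simpa [ψ, gN, y1] using this
  have φc := sp_pa_cont φpa
  have ψc := sp_pa_cont ψpa
  have φi : φ '' Icc 0 1 = Icc 0 1 := by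
    rw [φc.image_Icc_of_monotoneOn zero_le_one φm, φ0, φ1]
  have ψi : ψ '' Icc 0 1 = Icc 0 1 := by
    rw [ψc.image_Icc_of_monotoneOn zero_le_one ψm, ψ0, ψ1]
  have φM : MapsTo φ (Icc 0 1) (Icc 0 1) := fun t ht => φi ▸ mem_image_of_mem φ ht
  have ψM : MapsTo ψ (Icc 0 1) (Icc 0 1) := fun t ht => ψi ▸ mem_image_of_mem ψ ht
  have hτm : MonotoneOn (fun t => σ (φ t) + ρ (ψ t)) (Icc 0 1) := by
    intro a ha b hb hab
    exact add_le_add (hσm (φM ha) (φM hb) (φm ha hb hab)) (hρm (ψM ha) (ψM hb) (ψm ha hb hab))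
  have hτi : (fun t => σ (φ t) + ρ (ψ t)) '' Icc 0 1 = Icc 0 (N : ℝ) := by
    have hc : ContinuousOn (fun t => σ (φ t) + ρ (ψ t)) (Icc 0 1) :=
      ((sp_cont hσm hσi).comp φc φM).add ((sp_cont hρm hρi).comp ψc ψM)
    rw [hc.image_Icc_of_monotoneOn zero_le_one hτm]
    simp only [φ0, ψ0, φ1, ψ1, σ0, σ1, ρ0, ρ1, add_zero]
    rw [← hNsum]; push_cast; rfl
  have hfle : ∀ k ≤ N, f k ≤ P.shifts.length := fun k hk => fN ▸ fm hk
  have hgle : ∀ k ≤ N, g k ≤ Q.shifts.length := fun k hk => gN ▸ gm hk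
  have hmain : ∀ t ∈ Icc (0 : ℝ) 1, p (φ t) + q (ψ t) = R.param (σ (φ t) + ρ (ψ t)) := by
    intro t ht
    rw [hσ _ (φM ht), hρ _ (ψM ht)]
    obtain ⟨k, hk, k1, k2⟩ : ∃ k < N, (k : ℝ) ≤ N * t ∧ N * t ≤ k + 1 := by
      have ht0 : (0 : ℝ) ≤ N * t := mul_nonneg hN'.le ht.1
      have ht1 : (N : ℝ) * t ≤ N := by nlinarith [ht.2]
      rcases ht1.lt_or_eq with h | h
      · exact ⟨⌊(N : ℝ) * t⌋₊, (Nat.floor_lt ht0).2 h, Nat.floor_le ht0,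
          (Nat.lt_floor_add_one _).le⟩
      · refine ⟨N - 1, by omega, ?_, ?_⟩ <;> rw [h, Nat.cast_sub hN] <;> simp
    obtain ⟨e1, e2⟩ := hadd k hk.le
    have hv : R.vert k = P.vert (f k) + Q.vert (g k) := by
      simp only [Polyline.vert]
      rw [e2, hR]
      simp only [sortedSum]
      abel
    have mx := spInterp_mem cxm k1 k2
    have my := spInterp_mem cym k1 k2
    change x (f k) ≤ φ t ∧ φ t ≤ x (f (k + 1)) at mx
    change y (g k) ≤ ψ t ∧ ψ t ≤ y (g (k + 1)) at my
    have sx1 := hσm (xI _) (φM ht) mx.1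
    have sx2 := hσm (φM ht) (xI _) mx.2
    have sy1 := hρm (yI _) (ψM ht) my.1
    have sy2 := hρm (ψM ht) (yI _) my.2
    rw [hx _ (hfle _ hk.le)] at sx1
    rw [hx _ (hfle _ hk)] at sx2
    rw [hy _ (hgle _ hk.le)] at sy1
    rw [hy _ (hgle _ hk)] at sy2
    rcases hstep k hk with ⟨u, v, w⟩ | ⟨u, v, w⟩
    · rw [u] at sx2
      rw [v] at sy2
      push_cast at sx2
      exact sp_step P Q R e1 hv w sx1 sx2 (le_antisymm sy2 sy1)
    · rw [u] at sy2
      rw [v] at sx2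
      push_cast at sy2
      rw [add_comm, add_comm (σ (φ t))]
      exact sp_step Q P R (f := g) (g := f) (by omega) (by rw [hv, add_comm]) w sy1 sy2
        (le_antisymm sx2 sx1)
  refine ⟨φ, ψ, φm, ψm, φpa, ψpa, φi, ψi, ⟨_, hτm, hτi, hmain⟩, ?_⟩
  rintro _ ⟨s, hs, rfl⟩
  rw [← hNdef, ← hτi] at hs
  obtain ⟨t, ht, rfl⟩ := hs
  show R.param (σ (φ t) + ρ (ψ t)) ∈ _
  rw [← hmain t ht, hσ _ (φM ht), hρ _ (ψM ht)]
  refine Set.add_mem_add ⟨_, ?_, rfl⟩ ⟨_, ?_, rfl⟩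
  · rw [← hσi]; exact mem_image_of_mem σ (φM ht)
  · rw [← hρi]; exact mem_image_of_mem ρ (ψM ht)
end
end

section
/- Let P and Q be non-reverse polylines satisfying the hypotheses of the sorted sum (first shifts of the same direction and rot P = rot Q). If aco P > −π and aco Q > −π, then the sorted sum R = P +ₛ Q is non-reverse. -/
open Real Set Pointwise

noncomputable section

/-- The complex number of a plane vector. -/
def toC (v : ℝ × ℝ) : ℂ := v.1 + v.2 * Complex.I

/-- The direction of a plane vector as an angle. -/
def dirAng (v : ℝ × ℝ) : Real.Angle := (Complex.arg (toC v) : Real.Angle)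

theorem toC_re (v : ℝ × ℝ) : (toC v).re = v.1 := by simp [toC]

theorem toC_im (v : ℝ × ℝ) : (toC v).im = v.2 := by simp [toC]

theorem toC_ne {v : ℝ × ℝ} (hv : v ≠ 0) : toC v ≠ 0 := by
  intro h
  apply hv
  have h1 := toC_re v
  have h2 := toC_im v
  rw [h] at h1 h2
  ext
  · simpa using h1.symm
  · simpa using h2.symm

theorem toC_smul (a : ℝ) (v : ℝ × ℝ) : toC (a • v) = (a : ℂ) * toC v := by
  simp [toC]; ring

theorem toC_inj {v w : ℝ × ℝ} (h : toC v = toC w) : v = w := by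
  have h1 := congrArg Complex.re h
  have h2 := congrArg Complex.im h
  rw [toC_re, toC_re] at h1
  rw [toC_im, toC_im] at h2
  exact Prod.ext h1 h2

theorem vangle_eq (v w : ℝ × ℝ) : vangle v w = Complex.arg (toC w / toC v) := rfl

theorem vangle_coe {v w : ℝ × ℝ} (hv : v ≠ 0) (hw : w ≠ 0) :
    (vangle v w : Real.Angle) = dirAng w - dirAng v := by
  rw [vangle_eq]
  exact Complex.arg_div_coe_angle (toC_ne hw) (toC_ne hv)

theorem vangle_lt {v w : ℝ × ℝ} (hv : v ≠ 0) (h : ¬ Opp v w) : vangle v w < π := by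
  rw [vangle_eq]
  refine lt_of_le_of_ne (Complex.arg_le_pi _) fun hpi => h ?_
  rw [Complex.arg_eq_pi_iff] at hpi
  obtain ⟨h1, h2⟩ := hpi
  refine ⟨_, h1, toC_inj ?_⟩
  rw [toC_smul]
  have hz : (((toC w / toC v).re : ℝ) : ℂ) = toC w / toC v := by
    apply Complex.ext <;> simp [h2]
  rw [hz, div_mul_cancel₀ _ (toC_ne hv)]

theorem not_opp_of {v w : ℝ × ℝ} {r : ℝ} (hv : v ≠ 0) (hw : w ≠ 0)
    (hr : dirAng w - dirAng v = (r : Real.Angle)) (h0 : 0 ≤ r) (h1 : r < π) : ¬ Opp v w := by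
  rintro ⟨a, ha, hwa⟩
  have hpi : vangle v w = π := by
    rw [vangle_eq, hwa, toC_smul, mul_div_cancel_right₀ _ (toC_ne hv)]
    exact Complex.arg_ofReal_of_neg ha
  have h2 : ((π : ℝ) : Real.Angle) = (r : Real.Angle) := by
    rw [← hr, ← vangle_coe hv hw, hpi]
  have h3 := congrArg Real.Angle.toReal h2
  rw [Real.Angle.toReal_pi, Real.Angle.toReal_coe_eq_self_iff.2 ⟨by linarith, h1.le⟩] at h3
  linarith

/-- A shift sequence with good suffixes and last direction `Θ`. -/
def Good (Θ : Real.Angle) : List (ℝ × ℝ) → Prop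
  | [] => True
  | a :: s => a ≠ 0 ∧ dirAng a + (rotShifts (a :: s) : Real.Angle) = Θ ∧
      -π < rotShifts (a :: s) ∧ (∀ x ∈ s.head?, ¬ Opp a x) ∧ Good Θ s

theorem rot_step {Θ : Real.Angle} {a : ℝ × ℝ} {s : List (ℝ × ℝ)} (h : Good Θ (a :: s)) :
    rotShifts (a :: s) < rotShifts s + π := by
  obtain ⟨h1, h2, h3, h4, h5⟩ := h
  cases s with
  | nil => simp [rotShifts, Real.pi_pos]
  | cons b s =>
    have := vangle_lt h1 (h4 b (by simp))
    simp only [rotShifts] at *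
    linarith

theorem not_opp_heads {Θ : Real.Angle} {a b : ℝ × ℝ} {s t : List (ℝ × ℝ)}
    (ha : Good Θ (a :: s)) (hb : Good Θ (b :: t))
    (h1 : rotShifts (b :: t) ≤ rotShifts (a :: s))
    (h2 : rotShifts (a :: s) < rotShifts (b :: t) + π) : ¬ Opp a b := by
  refine not_opp_of (r := rotShifts (a :: s) - rotShifts (b :: t)) ha.1 hb.1 ?_
    (by linarith) (by linarith)
  have e1 := ha.2.1
  have e2 := hb.2.1
  rw [Real.Angle.coe_sub, sub_eq_sub_iff_add_eq_add, e2, ← e1, add_comm]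

theorem merge_nil_left (t : List (ℝ × ℝ)) : sortedMerge [] t = t := by
  rw [sortedMerge]

theorem merge_nil_right (s : List (ℝ × ℝ)) : sortedMerge s [] = s := by
  cases s <;> simp [sortedMerge]

theorem merge_cons (a b : ℝ × ℝ) (s t : List (ℝ × ℝ)) :
    sortedMerge (a :: s) (b :: t) =
      if rotShifts (b :: t) ≤ rotShifts (a :: s) then a :: sortedMerge s (b :: t)
      else b :: sortedMerge (a :: s) t := by
  rw [sortedMerge]

theorem good_chain {Θ : Real.Angle} : ∀ {s : List (ℝ × ℝ)}, Good Θ s →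
    List.IsChain (fun v w => ¬ Opp v w) s
  | [], _ => List.isChain_nil
  | _ :: _, h => List.isChain_cons.2 ⟨h.2.2.2.1, good_chain h.2.2.2.2⟩

theorem merge_chain {Θ : Real.Angle} : ∀ (n : ℕ) (s t : List (ℝ × ℝ)), s.length + t.length ≤ n →
    Good Θ s → Good Θ t → List.IsChain (fun v w => ¬ Opp v w) (sortedMerge s t) := by
  intro n
  induction n with
  | zero =>
    intro s t hn hs ht
    have : s = [] := List.length_eq_zero_iff.1 (by omega)
    subst this
    rw [merge_nil_left]
    exact good_chain ht
  | succ n ih =>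
    intro s t hn hs ht
    cases s with
    | nil => rw [merge_nil_left]; exact good_chain ht
    | cons a s =>
    cases t with
    | nil => rw [merge_nil_right]; exact good_chain hs
    | cons b t =>
    have hra := rot_step hs
    have hrb := rot_step ht
    simp only [List.length_cons] at hn
    rw [merge_cons]
    split_ifs with hc
    · refine List.isChain_cons.2 ⟨?_, ih _ _ (by simp; omega) hs.2.2.2.2 ht⟩
      cases s with
      | nil =>
        rw [merge_nil_left]
        rintro x hx
        simp at hx
        subst hx
        have := ht.2.2.1
        refine not_opp_heads hs ht hc ?_
        simp only [rotShifts] at *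
        linarith
      | cons a' s =>
        rw [merge_cons]
        split_ifs with hc'
        · rintro x hx
          simp at hx
          subst hx
          exact hs.2.2.2.1 _ (by simp)
        · rintro x hx
          simp at hx
          subst hx
          exact not_opp_heads hs ht hc (by linarith)
    · refine List.isChain_cons.2 ⟨?_, ih _ _ (by simp; omega) hs ht.2.2.2.2⟩
      cases t with
      | nil =>
        rw [merge_nil_right]
        rintro x hx
        simp at hx
        subst hx
        have := hs.2.2.1
        refine not_opp_heads ht hs (by linarith) ?_
        simp only [rotShifts] at *
        linarith
      | cons b' t =>
        rw [merge_cons]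
        split_ifs with hc'
        · rintro x hx
          simp at hx
          subst hx
          exact not_opp_heads ht hs (by linarith) (by linarith)
        · rintro x hx
          simp at hx
          subst hx
          exact ht.2.2.2.1 _ (by simp)

theorem good_of {Θ : Real.Angle} : ∀ (s : List (ℝ × ℝ)), (∀ v ∈ s, v ≠ 0) →
    List.IsChain (fun v w => ¬ Opp v w) s → (∀ t, t <:+: s → -π < rotShifts t) →
    (∀ x ∈ s.head?, dirAng x + (rotShifts s : Real.Angle) = Θ) → Good Θ s := by
  intro s
  induction s with
  | nil => intros; trivial
  | cons a s ih =>
    intro h0 hch haco hd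
    rw [List.isChain_cons] at hch
    have hda := hd a (by simp)
    refine ⟨h0 a (by simp), hda, haco _ List.infix_rfl, hch.1,
      ih (fun v hv => h0 v (by simp [hv])) hch.2
        (fun t ht => haco t (ht.trans (List.suffix_cons a s).isInfix)) ?_⟩
    cases s with
    | nil => simp
    | cons b s =>
      intro x hx
      simp at hx
      subst hx
      rw [← hda]
      have e : rotShifts (a :: b :: s) = vangle a b + rotShifts (b :: s) := rfl
      rw [e, Real.Angle.coe_add, vangle_coe (h0 a (by simp)) (h0 b (by simp))]
      abel

theorem aco_lt {s : List (ℝ × ℝ)} (h : -π < acoShifts s) (t : List (ℝ × ℝ)) (ht : t <:+: s) :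
    -π < rotShifts t := by
  refine lt_of_lt_of_le h (csInf_le ?_ ⟨t, ht, rfl⟩)
  apply Set.Finite.bddBelow
  apply Set.Finite.image
  refine (List.finite_toSet s.sublists).subset ?_
  intro u hu
  exact List.mem_sublists.2 (List.IsInfix.sublist hu)

/-- **Lemma (correctness of the sorted sum).** If `P, Q` satisfy the sorted-sum
hypotheses and `aco P, aco Q > -π`, then `P +ₛ Q` is non-reverse. -/
theorem sortedSum_nonReverse (P Q : Polyline) (h : SortedSumHyp P Q)
    (hP : -π < acoShifts P.shifts) (hQ : -π < acoShifts Q.shifts) :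
    NonReverse (sortedSum P Q).shifts := by
  obtain ⟨⟨hPn, hP0⟩, ⟨hQn, hQ0⟩, hPr, hQr, hang, hrot⟩ := h
  change List.IsChain _ (sortedMerge P.shifts Q.shifts)
  revert hP hQ hPn hP0 hQn hQ0 hPr hQr hang hrot
  generalize P.shifts = s
  generalize Q.shifts = t
  intro hP hQ hPn hP0 hQn hQ0 hPr hQr hang hrot
  obtain ⟨a, s, rfl⟩ := List.exists_cons_of_ne_nil hPn
  obtain ⟨b, t, rfl⟩ := List.exists_cons_of_ne_nil hQn
  have hab : dirAng b = dirAng a := by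
    have h1 := vangle_coe (hP0 a (by simp)) (hQ0 b (by simp))
    simp only [List.headI_cons] at hang
    rw [hang, Real.Angle.coe_zero] at h1
    exact sub_eq_zero.1 h1.symm
  refine merge_chain (Θ := dirAng a + (rotShifts (a :: s) : Real.Angle)) _ _ _ le_rfl ?_ ?_
  · exact good_of _ hP0 hPr (aco_lt hP) (by simp)
  · refine good_of _ hQ0 hQr (aco_lt hQ) ?_
    intro x hx
    simp at hx
    subst hx
    rw [hab, hrot]
end
end
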